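/- Let m ∈ (1,2]. Then 𝓛(m) ≥ g_{0 1̄}(m). Moreover: (i) 𝓛(m) ≥ g_{σ(1 0̄)}(m) for every σ ∈ {L,M,R}* with m ≤ μ_{σ(01 0̄)}; (ii) 𝓛(m) ≥ f_{σ(0 1̄)}(m) for every σ ∈ {L,M,R}* with m ≥ μ_{σ(10 1̄)}; (iii) for every u ∈ S_{L,M,R}, 𝓛(m) ≥ g_u(m) if m ≤ μ_u and 𝓛(m) ≥ f_u(m) if m ≥ μ_u. -/

import Mathlib

/-- `π_β(u)` for a binary sequence `u = u₁u₂⋯` (indexed from 0). -/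
noncomputable def piB (β : ℝ) (u : ℕ → Bool) : ℝ :=
  ∑' k : ℕ, (if u k then (1 : ℝ) else 0) / β ^ (k + 1)

/-- `π_β(u)` for a real digit sequence. -/
noncomputable def piR (β : ℝ) (u : ℕ → ℝ) : ℝ := ∑' k : ℕ, u k / β ^ (k + 1)

/-- A binary sequence viewed as a real digit sequence. -/
def bR (u : ℕ → Bool) : ℕ → ℝ := fun k => if u k then 1 else 0

/-- `U_β(A)`: sequences with digits in `A` whose `π_β`-value has no other expansion over `A`. -/
def Uset (β : ℝ) (A : Set ℝ) : Set (ℕ → ℝ) :=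
  {u | (∀ k, u k ∈ A) ∧ ∀ v : ℕ → ℝ, (∀ k, v k ∈ A) → v ≠ u → piR β v ≠ piR β u}

/-- `𝓛(m) = inf {β > 1 : U_β(m) ∩ {0,1}^ℕ is uncountable}`. -/
noncomputable def Lval (m : ℝ) : ℝ :=
  sInf {β : ℝ | 1 < β ∧ ¬ (Uset β {0, 1, m} ∩ {v | ∃ u : ℕ → Bool, v = bR u}).Countable}

/-- The shift orbit `O(u)` of an infinite binary word. -/
def orbit (u : ℕ → Bool) : Set (ℕ → Bool) := {v | ∃ k : ℕ, v = fun i => u (i + k)}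

/-- Suffixes of `u` preceded by the letter `1`. -/
def orbit1 (u : ℕ → Bool) : Set (ℕ → Bool) :=
  {v | ∃ k : ℕ, u k = true ∧ v = fun i => u (i + k + 1)}

/-- Suffixes of `u` preceded by the letter `0`. -/
def orbit0 (u : ℕ → Bool) : Set (ℕ → Bool) :=
  {v | ∃ k : ℕ, u k = false ∧ v = fun i => u (i + k + 1)}

open Classical in
/-- The lexicographic supremum of a set of binary sequences (greedy construction);
`⊥ = 0̄` for the empty set. -/
noncomputable def lexSupSeq (S : Set (ℕ → Bool)) : ℕ → Bool
  | n => decide (∃ u ∈ S, (∀ i, i < n → u i = lexSupSeq S i) ∧ u n = true)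
  termination_by n => n

open Classical in
/-- The lexicographic infimum of a set of binary sequences (greedy construction);
`⊤ = 1̄` for the empty set. -/
noncomputable def lexInfSeq (S : Set (ℕ → Bool)) : ℕ → Bool
  | n => decide (¬ ∃ u ∈ S, (∀ i, i < n → u i = lexInfSeq S i) ∧ u n = false)
  termination_by n => n

/-- `sup O(u)`, the lexicographically largest limit of suffixes of `u`. -/
noncomputable def supO (u : ℕ → Bool) : ℕ → Bool := lexSupSeq (orbit u)
/-- `inf O(u)`. -/
noncomputable def infO (u : ℕ → Bool) : ℕ → Bool := lexInfSeq (orbit u)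
/-- `sup₀(u)`, the supremum of the suffixes preceded by `0`. -/
noncomputable def sup0 (u : ℕ → Bool) : ℕ → Bool := lexSupSeq (orbit0 u)
/-- `inf₁(u)`, the infimum of the suffixes preceded by `1`. -/
noncomputable def inf1 (u : ℕ → Bool) : ℕ → Bool := lexInfSeq (orbit1 u)

/-- Strict lexicographic order on infinite binary words. -/
def lexLt (u v : ℕ → Bool) : Prop := ∃ n, (∀ i, i < n → u i = v i) ∧ u n < v n
/-- Lexicographic order on infinite binary words. -/
def lexLe (u v : ℕ → Bool) : Prop := lexLt u v ∨ u = v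

/-- `f_u(m)`: the unique `β ≥ 1` with `β·π_β(sup O(u)) = m`. -/
noncomputable def fVal (u : ℕ → Bool) (m : ℝ) : ℝ :=
  sInf {β : ℝ | 1 ≤ β ∧ β * piB β (supO u) = m}

/-- `g_u(m)`: the unique `β > 1` with `(β-1)(1+π_β(inf O(u))) = m`. -/
noncomputable def gVal (u : ℕ → Bool) (m : ℝ) : ℝ :=
  sInf {β : ℝ | 1 < β ∧ (β - 1) * (1 + piB β (infO u)) = m}

/-- `μ_u`: the unique `m ∈ (1,2]` with `f_u(m) = g_u(m)`. -/
noncomputable def muVal (u : ℕ → Bool) : ℝ :=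
  sInf {m : ℝ | 1 < m ∧ m ≤ 2 ∧ fVal u m = gVal u m}

/-- `u` contains at least two ones. -/
def TwoOnes (u : ℕ → Bool) : Prop := ∃ k l, k < l ∧ u k = true ∧ u l = true

/-- The substitution `L : 0 ↦ 0, 1 ↦ 01` (with `0 = false`, `1 = true`). -/
def Lsub : Bool → List Bool := fun b => if b then [false, true] else [false]
/-- The substitution `M : 0 ↦ 01, 1 ↦ 10`. -/
def Msub : Bool → List Bool := fun b => if b then [true, false] else [false, true]
/-- The substitution `R : 0 ↦ 01, 1 ↦ 1`. -/
def Rsub : Bool → List Bool := fun b => if b then [true] else [false, true]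
/-- The identity substitution. -/
def idSub : Bool → List Bool := fun b => [b]
/-- Composition of substitutions: `compSub σ τ = σ ∘ τ` (apply `τ` first). -/
def compSub (σ τ : Bool → List Bool) : Bool → List Bool := fun b => (τ b).flatMap σ

/-- The monoid `{L,M,R}*` generated by the three substitutions. -/
def LMRstar : Set (Bool → List Bool) :=
  {σ | ∃ l : List (Bool → List Bool),
    (∀ τ ∈ l, τ = Lsub ∨ τ = Msub ∨ τ = Rsub) ∧ σ = l.foldr compSub idSub}

/-- A substitution applied to an infinite word, `σ(u₁)σ(u₂)⋯`. -/
noncomputable def substApply (σ : Bool → List Bool) (u : ℕ → Bool) : ℕ → Bool := fun n =>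
  let k := sSup {k : ℕ | (∑ i ∈ Finset.range k, (σ (u i)).length) ≤ n}
  (σ (u k)).getD (n - ∑ i ∈ Finset.range k, (σ (u i)).length) false

/-- `u` is a limit word of the sequence of substitutions `σseq`. -/
def IsLimitWord (σseq : ℕ → Bool → List Bool) (u : ℕ → Bool) : Prop :=
  ∃ useq : ℕ → ℕ → Bool, useq 0 = u ∧ ∀ n, useq n = substApply (σseq n) (useq (n + 1))

/-- Primitivity of a sequence of substitutions in `{L,M,R}^ℕ`: no tail is constantly `L`
and no tail is constantly `R`. -/
def PrimitiveSeq (σseq : ℕ → Bool → List Bool) : Prop :=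
  (¬ ∃ k, ∀ n, k ≤ n → σseq n = Lsub) ∧ ¬ ∃ k, ∀ n, k ≤ n → σseq n = Rsub

/-- `S_{L,M,R}`: the set of limit words of primitive sequences of substitutions. -/
def Sset : Set (ℕ → Bool) :=
  {u | ∃ σseq : ℕ → Bool → List Bool,
    (∀ n, σseq n = Lsub ∨ σseq n = Msub ∨ σseq n = Rsub) ∧
    PrimitiveSeq σseq ∧ IsLimitWord σseq u}

/-- The word `1 0̄ = 1000⋯`. -/
def w10bar : ℕ → Bool := fun n => decide (n = 0)
/-- The word `0 1̄ = 0111⋯`. -/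
def w01bar : ℕ → Bool := fun n => decide (n ≠ 0)
/-- The word `01 0̄ = 01000⋯`. -/
def w010bar : ℕ → Bool := fun n => decide (n = 1)
/-- The word `10 1̄ = 10111⋯`. -/
def w101bar : ℕ → Bool := fun n => decide (n ≠ 1)
/-- The word `0̄`. -/
def w0bar : ℕ → Bool := fun _ => false
/-- The word `1̄`. -/
def w1bar : ℕ → Bool := fun _ => true

/-- Prepend a letter to an infinite word. -/
def consB (b : Bool) (u : ℕ → Bool) : ℕ → Bool := fun n =>
  match n with
  | 0 => b
  | Nat.succ k => u k

/-- Prepend a finite word to an infinite word. -/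
def appendW (w : List Bool) (v : ℕ → Bool) : ℕ → Bool := fun n =>
  if n < w.length then w.getD n false else v (n - w.length)

/-! ### Infinite words, shifts and the lexicographic order -/

/-- The word `u` with its first `k` letters removed. -/
def shiftW (k : ℕ) (u : ℕ → Bool) : ℕ → Bool := fun i => u (i + k)

@[simp] lemma shiftW_zero (u : ℕ → Bool) : shiftW 0 u = u := rfl

@[simp] lemma shiftW_shiftW (j k : ℕ) (u : ℕ → Bool) :
    shiftW j (shiftW k u) = shiftW (j + k) u := by
  funext i; simp only [shiftW, Nat.add_assoc]

lemma shiftW_apply (k : ℕ) (u : ℕ → Bool) (i : ℕ) : shiftW k u i = u (i + k) := rfl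

@[simp] lemma shiftW_apply_zero (k : ℕ) (u : ℕ → Bool) : shiftW k u 0 = u k := by
  simp [shiftW]

@[simp] lemma consB_zero (b : Bool) (u : ℕ → Bool) : consB b u 0 = b := rfl

@[simp] lemma consB_succ (b : Bool) (u : ℕ → Bool) (n : ℕ) : consB b u (n + 1) = u n := rfl

@[simp] lemma shiftW_succ_consB (k : ℕ) (b : Bool) (u : ℕ → Bool) :
    shiftW (k + 1) (consB b u) = shiftW k u := rfl

@[simp] lemma shiftW_one_consB (b : Bool) (u : ℕ → Bool) : shiftW 1 (consB b u) = u := rfl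

lemma consB_head_tail (u : ℕ → Bool) : consB (u 0) (shiftW 1 u) = u := by
  funext i; cases i <;> rfl

lemma eq_consB_of_head {u : ℕ → Bool} {b : Bool} (h : u 0 = b) : u = consB b (shiftW 1 u) := by
  rw [← h, consB_head_tail]

lemma shiftW_eq_consB (k : ℕ) (u : ℕ → Bool) : shiftW k u = consB (u k) (shiftW (k + 1) u) := by
  rw [← consB_head_tail (shiftW k u)]
  simp [Nat.add_comm]

lemma shiftW_mem_orbit (k : ℕ) (u : ℕ → Bool) : shiftW k u ∈ orbit u := ⟨k, rfl⟩

lemma lexLt_iff_toLex {u v : ℕ → Bool} : lexLt u v ↔ toLex u < toLex v := Iff.rfl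

lemma lexLe_iff_toLex {u v : ℕ → Bool} : lexLe u v ↔ toLex u ≤ toLex v := by
  rw [le_iff_lt_or_eq]; exact Iff.rfl

lemma lexLt.trans {u v w : ℕ → Bool} (h : lexLt u v) (h' : lexLt v w) : lexLt u w :=
  lt_trans (lexLt_iff_toLex.1 h) (lexLt_iff_toLex.1 h')

lemma lexLe.trans_lt {u v w : ℕ → Bool} (h : lexLe u v) (h' : lexLt v w) : lexLt u w :=
  lt_of_le_of_lt (lexLe_iff_toLex.1 h) (lexLt_iff_toLex.1 h')

lemma lexLt.trans_le {u v w : ℕ → Bool} (h : lexLt u v) (h' : lexLe v w) : lexLt u w :=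
  lt_of_lt_of_le (lexLt_iff_toLex.1 h) (lexLe_iff_toLex.1 h')

lemma lexLt_irrefl (u : ℕ → Bool) : ¬ lexLt u u := lt_irrefl (toLex u)

lemma lexLe_refl (u : ℕ → Bool) : lexLe u u := Or.inr rfl

lemma not_lexLt {u v : ℕ → Bool} : ¬ lexLt u v ↔ lexLe v u := by
  rw [lexLt_iff_toLex, lexLe_iff_toLex]
  exact not_lt (α := Lex (ℕ → Bool))

lemma lexLe_antisymm {u v : ℕ → Bool} (h : lexLe u v) (h' : lexLe v u) : u = v :=
  toLex.injective (le_antisymm (lexLe_iff_toLex.1 h) (lexLe_iff_toLex.1 h'))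

@[simp] lemma lexLt_consB_same (b : Bool) (u v : ℕ → Bool) :
    lexLt (consB b u) (consB b v) ↔ lexLt u v := by
  constructor
  · rintro ⟨n, h1, h2⟩
    cases n with
    | zero => simp at h2
    | succ n => exact ⟨n, fun i hi => h1 (i + 1) (by omega), h2⟩
  · rintro ⟨n, h1, h2⟩
    refine ⟨n + 1, fun i hi => ?_, h2⟩
    cases i with
    | zero => rfl
    | succ i => exact h1 i (by omega)

@[simp] lemma lexLe_consB_same (b : Bool) (u v : ℕ → Bool) :
    lexLe (consB b u) (consB b v) ↔ lexLe u v := by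
  rw [← not_lexLt, ← not_lexLt, lexLt_consB_same]

lemma lexLt_of_head {u v : ℕ → Bool} (hu : u 0 = false) (hv : v 0 = true) : lexLt u v :=
  ⟨0, by simp, by rw [hu, hv]; decide⟩

@[simp] lemma lexLt_consB_false_true (u v : ℕ → Bool) :
    lexLt (consB false u) (consB true v) := lexLt_of_head rfl rfl

@[simp] lemma not_lexLt_consB_true_false (u v : ℕ → Bool) :
    ¬ lexLt (consB true u) (consB false v) := fun h =>
  lexLt_irrefl _ (h.trans (lexLt_consB_false_true _ _))

lemma w0bar_lexLe (u : ℕ → Bool) : lexLe w0bar u := by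
  rw [← not_lexLt]
  rintro ⟨n, -, h⟩
  simp [w0bar, Bool.lt_iff] at h

lemma lexLe_w1bar (u : ℕ → Bool) : lexLe u w1bar := by
  rw [← not_lexLt]
  rintro ⟨n, -, h⟩
  simp [w1bar, Bool.lt_iff] at h

lemma consB_false_lexLe (u : ℕ → Bool) : lexLe (consB false u) u := by
  rw [← not_lexLt]
  rintro ⟨n, h1, h2⟩
  have h3 : ∀ i, i < n → u i = false := by
    intro i
    induction i with
    | zero => intro hi; exact h1 0 hi
    | succ i ih => intro hi; rw [h1 (i + 1) hi]; exact ih (by omega)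
  cases n with
  | zero => simp [Bool.lt_iff] at h2
  | succ n => simp [h3 n (by omega), Bool.lt_iff] at h2

lemma lexLe_consB_true (u : ℕ → Bool) : lexLe u (consB true u) := by
  rw [← not_lexLt]
  rintro ⟨n, h1, h2⟩
  have h3 : ∀ i, i < n → u i = true := by
    intro i
    induction i with
    | zero => intro hi; exact (h1 0 hi).symm
    | succ i ih => intro hi; rw [← h1 (i + 1) hi]; exact ih (by omega)
  cases n with
  | zero => simp [Bool.lt_iff] at h2
  | succ n => simp [h3 n (by omega), Bool.lt_iff] at h2

/-! ### Substitutions on infinite words -/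

lemma appendW_nil (v : ℕ → Bool) : appendW [] v = v := by
  funext n; simp [appendW]

lemma appendW_cons (b : Bool) (l : List Bool) (v : ℕ → Bool) :
    appendW (b :: l) v = consB b (appendW l v) := by
  funext n
  cases n with
  | zero => simp [appendW]
  | succ n => simp [appendW]

lemma appendW_append (l l' : List Bool) (v : ℕ → Bool) :
    appendW (l ++ l') v = appendW l (appendW l' v) := by
  induction l with
  | nil => simp [appendW_nil]
  | cons b l ih => simp [appendW_cons, ih]

lemma substApply_block {σ : Bool → List Bool} (hσ : ∀ b, σ b ≠ []) (u : ℕ → Bool) (k j : ℕ)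
    (hj : j < (σ (u k)).length) :
    substApply σ u (∑ i ∈ Finset.range k, (σ (u i)).length + j) = (σ (u k)).getD j false := by
  have hmono : Monotone fun k => ∑ i ∈ Finset.range k, (σ (u i)).length :=
    monotone_nat_of_le_succ fun n => by simp [Finset.sum_range_succ]
  have hset : {k' : ℕ | (∑ i ∈ Finset.range k', (σ (u i)).length) ≤
      ∑ i ∈ Finset.range k, (σ (u i)).length + j} = Set.Iic k := by
    ext k'
    simp only [Set.mem_ofPred_eq, Set.mem_Iic]
    constructor
    · intro h
      by_contra hk
      have h1 := hmono (show k + 1 ≤ k' by omega)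
      simp only [Finset.sum_range_succ] at h1
      omega
    · intro h
      have := hmono h
      simp only at this
      omega
  have : ∀ b, 0 < (σ b).length := fun b => List.length_pos_of_ne_nil (hσ b)
  simp only [substApply]
  rw [hset, csSup_Iic]
  simp

lemma substApply_unfold {σ : Bool → List Bool} (hσ : ∀ b, σ b ≠ []) (u : ℕ → Bool) :
    substApply σ u = appendW (σ (u 0)) (substApply σ (shiftW 1 u)) := by
  have hpos : ∀ b, 0 < (σ b).length := fun b => List.length_pos_of_ne_nil (hσ b)
  have hpart : ∀ (x : ℕ → Bool) (n : ℕ), ∃ k j, j < (σ (x k)).length ∧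
      n = ∑ i ∈ Finset.range k, (σ (x i)).length + j := by
    intro x n
    induction n with
    | zero => exact ⟨0, 0, hpos _, by simp⟩
    | succ n ih =>
      obtain ⟨k, j, hj, hn⟩ := ih
      rcases Nat.lt_or_ge (j + 1) (σ (x k)).length with h | h
      · exact ⟨k, j + 1, h, by omega⟩
      · exact ⟨k + 1, 0, hpos _, by rw [Finset.sum_range_succ]; omega⟩
  funext n
  by_cases hn : n < (σ (u 0)).length
  · have := substApply_block hσ u 0 n hn
    simp only [Finset.range_zero, Finset.sum_empty, Nat.zero_add] at this
    rw [this]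
    simp [appendW, hn]
  · obtain ⟨k, j, hj, hk⟩ := hpart (shiftW 1 u) (n - (σ (u 0)).length)
    have h1 := substApply_block hσ (shiftW 1 u) k j hj
    have h2 := substApply_block hσ u (k + 1) j hj
    rw [← hk] at h1
    have h3 : n = ∑ i ∈ Finset.range (k + 1), (σ (u i)).length + j := by
      rw [Finset.sum_range_succ']
      simp only [shiftW] at hk
      omega
    rw [← h3] at h2
    rw [h2]
    simp only [appendW, hn, if_false]
    rw [h1]
    rfl

lemma substApply_eq_of_unfold {σ : Bool → List Bool} (hσ : ∀ b, σ b ≠ []) (V : ℕ → ℕ → Bool)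
    (y : ℕ → Bool) (h : ∀ k, V k = appendW (σ (y k)) (V (k + 1))) : V 0 = substApply σ y := by
  have key : ∀ n k, V k n = substApply σ (shiftW k y) n := by
    intro n
    induction n using Nat.strong_induction_on with
    | _ n ih =>
      intro k
      rw [h k, substApply_unfold hσ, shiftW_apply_zero, shiftW_shiftW, Nat.add_comm 1 k]
      simp only [appendW]
      split_ifs with hn
      · rfl
      · have := List.length_pos_of_ne_nil (hσ (y k))
        exact ih _ (by omega) _
  funext n
  simpa using key n 0

lemma substApply_appendW {σ : Bool → List Bool} (hσ : ∀ b, σ b ≠ []) (l : List Bool)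
    (v : ℕ → Bool) :
    substApply σ (appendW l v) = appendW (l.flatMap σ) (substApply σ v) := by
  induction l with
  | nil => simp [appendW_nil]
  | cons b l ih =>
    rw [appendW_cons, substApply_unfold hσ, List.flatMap_cons, appendW_append]
    simp [ih]

lemma compSub_ne_nil {σ τ : Bool → List Bool} (hσ : ∀ b, σ b ≠ []) (hτ : ∀ b, τ b ≠ [])
    (b : Bool) : compSub σ τ b ≠ [] := by
  obtain ⟨c, l, hl⟩ := List.exists_cons_of_ne_nil (hτ b)
  simp [compSub, hl, hσ c]

lemma substApply_compSub {σ τ : Bool → List Bool} (hσ : ∀ b, σ b ≠ []) (hτ : ∀ b, τ b ≠ [])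
    (u : ℕ → Bool) : substApply (compSub σ τ) u = substApply σ (substApply τ u) := by
  refine (substApply_eq_of_unfold (compSub_ne_nil hσ hτ)
    (fun k => substApply σ (substApply τ (shiftW k u))) u fun k => ?_).symm
  conv_lhs => rw [substApply_unfold hτ, substApply_appendW hσ]
  simp [compSub, Nat.add_comm]

lemma substApply_idSub (u : ℕ → Bool) : substApply idSub u = u := by
  refine (substApply_eq_of_unfold (by simp [idSub]) (fun k => shiftW k u) u fun k => ?_).symm
  simp only [idSub, appendW_cons, appendW_nil]
  exact shiftW_eq_consB k u

lemma Lsub_ne_nil (b : Bool) : Lsub b ≠ [] := by cases b <;> simp [Lsub]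
lemma Msub_ne_nil (b : Bool) : Msub b ≠ [] := by cases b <;> simp [Msub]
lemma Rsub_ne_nil (b : Bool) : Rsub b ≠ [] := by cases b <;> simp [Rsub]

@[simp] lemma substApply_Lsub_false (u : ℕ → Bool) :
    substApply Lsub (consB false u) = consB false (substApply Lsub u) := by
  rw [substApply_unfold Lsub_ne_nil]; simp [Lsub, appendW_cons, appendW_nil]

@[simp] lemma substApply_Lsub_true (u : ℕ → Bool) :
    substApply Lsub (consB true u) = consB false (consB true (substApply Lsub u)) := by
  rw [substApply_unfold Lsub_ne_nil]; simp [Lsub, appendW_cons, appendW_nil]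

@[simp] lemma substApply_Msub_false (u : ℕ → Bool) :
    substApply Msub (consB false u) = consB false (consB true (substApply Msub u)) := by
  rw [substApply_unfold Msub_ne_nil]; simp [Msub, appendW_cons, appendW_nil]

@[simp] lemma substApply_Msub_true (u : ℕ → Bool) :
    substApply Msub (consB true u) = consB true (consB false (substApply Msub u)) := by
  rw [substApply_unfold Msub_ne_nil]; simp [Msub, appendW_cons, appendW_nil]

@[simp] lemma substApply_Rsub_false (u : ℕ → Bool) :
    substApply Rsub (consB false u) = consB false (consB true (substApply Rsub u)) := by
  rw [substApply_unfold Rsub_ne_nil]; simp [Rsub, appendW_cons, appendW_nil]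

@[simp] lemma substApply_Rsub_true (u : ℕ → Bool) :
    substApply Rsub (consB true u) = consB true (substApply Rsub u) := by
  rw [substApply_unfold Rsub_ne_nil]; simp [Rsub, appendW_cons, appendW_nil]

lemma substApply_Lsub_zero (u : ℕ → Bool) : substApply Lsub u 0 = false := by
  rw [← consB_head_tail u]; cases u 0 <;> simp

lemma exists_shiftW_substApply {σ : Bool → List Bool} (hσ : ∀ b, σ b ≠ []) (u : ℕ → Bool)
    (k : ℕ) : ∃ j, shiftW j (substApply σ u) = substApply σ (shiftW k u) := by
  induction k with
  | zero => exact ⟨0, rfl⟩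
  | succ k ih =>
    obtain ⟨j, hj⟩ := ih
    refine ⟨(σ (u k)).length + j, ?_⟩
    rw [← shiftW_shiftW, hj, substApply_unfold hσ]
    funext i
    simp [shiftW, appendW, Nat.add_comm]

/-- A nonerasing substitution that is increasing on letters followed by arbitrary images is
strictly increasing for the lexicographic order. -/
lemma substApply_lexLt {σ : Bool → List Bool} (hσ : ∀ b, σ b ≠ [])
    (h01 : ∀ x y, lexLt (substApply σ (consB false x)) (substApply σ (consB true y)))
    {u v : ℕ → Bool} (h : lexLt u v) : lexLt (substApply σ u) (substApply σ v) := by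
  obtain ⟨n, h1, h2⟩ := h
  induction n generalizing u v with
  | zero =>
    rw [Bool.lt_iff] at h2
    rw [eq_consB_of_head h2.1, eq_consB_of_head h2.2]
    exact h01 _ _
  | succ n ih =>
    have h3 := ih (u := shiftW 1 u) (v := shiftW 1 v) (fun i hi => h1 (i + 1) (by omega)) h2
    rw [substApply_unfold hσ u, substApply_unfold hσ v, h1 0 (by omega)]
    generalize σ (v 0) = l
    induction l with
    | nil => simpa [appendW_nil] using h3
    | cons b l ih => simpa [appendW_cons] using ih

lemma substApply_lexLe {σ : Bool → List Bool} (hσ : ∀ b, σ b ≠ [])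
    (h01 : ∀ x y, lexLt (substApply σ (consB false x)) (substApply σ (consB true y)))
    {u v : ℕ → Bool} (h : lexLe u v) : lexLe (substApply σ u) (substApply σ v) := by
  rcases h with h | rfl
  · exact Or.inl (substApply_lexLt hσ h01 h)
  · exact lexLe_refl _

lemma substApply_lexLt_iff {σ : Bool → List Bool} (hσ : ∀ b, σ b ≠ [])
    (h01 : ∀ x y, lexLt (substApply σ (consB false x)) (substApply σ (consB true y)))
    {u v : ℕ → Bool} : lexLt (substApply σ u) (substApply σ v) ↔ lexLt u v := by
  refine ⟨fun h => ?_, substApply_lexLt hσ h01⟩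
  by_contra h'
  exact lexLt_irrefl _ (h.trans_le (substApply_lexLe hσ h01 (not_lexLt.1 h')))

lemma Lsub_letters (x y : ℕ → Bool) :
    lexLt (substApply Lsub (consB false x)) (substApply Lsub (consB true y)) := by
  simpa using lexLt_of_head (substApply_Lsub_zero x) rfl

lemma Msub_letters (x y : ℕ → Bool) :
    lexLt (substApply Msub (consB false x)) (substApply Msub (consB true y)) := by simp

lemma Rsub_letters (x y : ℕ → Bool) :
    lexLt (substApply Rsub (consB false x)) (substApply Rsub (consB true y)) := by simp

/-- `u` and `v` agree in their first `n` letters. -/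
def Agree (n : ℕ) (u v : ℕ → Bool) : Prop := ∀ i, i < n → u i = v i

lemma Agree.consB {n : ℕ} {u v : ℕ → Bool} (h : Agree n u v) (b : Bool) :
    Agree (n + 1) (consB b u) (consB b v) := by
  intro i hi
  cases i with
  | zero => rfl
  | succ i => exact h i (by omega)

lemma Agree.mono {n k : ℕ} {u v : ℕ → Bool} (h : Agree n u v) (hk : k ≤ n) : Agree k u v :=
  fun i hi => h i (by omega)

lemma Agree.tail {n : ℕ} {u v : ℕ → Bool} (h : Agree (n + 1) u v) :
    Agree n (shiftW 1 u) (shiftW 1 v) := fun i hi => h (i + 1) (by omega)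

lemma Agree.substApply {σ : Bool → List Bool} (hσ : ∀ b, σ b ≠ []) {n : ℕ} {u v : ℕ → Bool}
    (h : Agree n u v) : Agree n (substApply σ u) (substApply σ v) := by
  induction n generalizing u v with
  | zero => intro i hi; omega
  | succ n ih =>
    have h1 := ih h.tail
    rw [substApply_unfold hσ u, substApply_unfold hσ v, h 0 (by omega)]
    intro i hi
    simp only [appendW]
    split_ifs
    · rfl
    · have := List.length_pos_of_ne_nil (hσ (v 0))
      exact h1 _ (by omega)

lemma Agree.substApply_Lsub {n : ℕ} {u v : ℕ → Bool} (h : Agree n u v) :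
    Agree (n + 1) (_root_.substApply Lsub u) (_root_.substApply Lsub v) := by
  induction n generalizing u v with
  | zero =>
    intro i hi
    obtain rfl : i = 0 := by omega
    simp [substApply_Lsub_zero]
  | succ n ih =>
    have h1 := ih h.tail
    rw [← consB_head_tail u, ← consB_head_tail v, h 0 (by omega)]
    cases v 0
    · simpa using h1.consB false
    · simpa using ((h1.consB true).consB false).mono (by omega)

/-! ### Words all of whose suffixes lie strictly between two bounds -/

/-- The words all of whose suffixes lie strictly between `a` and `b`. -/
def betweenSet (a b : ℕ → Bool) : Set (ℕ → Bool) :=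
  {v | ∀ k, lexLt a (shiftW k v) ∧ lexLt (shiftW k v) b}

/-- All suffixes of `u` lie (weakly) between `a` and `b`. -/
def SuffixBounds (a b u : ℕ → Bool) : Prop :=
  ∀ k, lexLe a (shiftW k u) ∧ lexLe (shiftW k u) b

lemma countable_shiftW_mem {C : Set (ℕ → Bool)} (hC : C.Countable) :
    {v | ∃ k, shiftW k v ∈ C}.Countable := by
  have h : ∀ k, {v | shiftW k v ∈ C}.Countable := by
    intro k
    induction k with
    | zero => simpa using hC
    | succ k ih =>
      refine ((ih.image (consB false)).union (ih.image (consB true))).mono fun v hv => ?_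
      have hv' : shiftW k (shiftW 1 v) ∈ C := by simpa using hv
      cases h0 : v 0
      · exact Or.inl ⟨_, hv', (eq_consB_of_head h0).symm⟩
      · exact Or.inr ⟨_, hv', (eq_consB_of_head h0).symm⟩
  have : {v | ∃ k, shiftW k v ∈ C} = ⋃ k, {v | shiftW k v ∈ C} := by ext; simp
  rw [this]
  exact Set.countable_iUnion h

lemma exists_substApply_of_parse {σ : Bool → List Bool} (hσ : ∀ b, σ b ≠ [])
    {P : Set (ℕ → Bool)} (hP : ∀ v ∈ P, ∃ c, ∃ v' ∈ P, v = appendW (σ c) v')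
    {v : ℕ → Bool} (hv : v ∈ P) : ∃ y, v = substApply σ y := by
  choose! c nxt h1 h2 using hP
  have hmem : ∀ k, nxt^[k] v ∈ P := by
    intro k
    induction k with
    | zero => exact hv
    | succ k ih => rw [Function.iterate_succ_apply']; exact h1 _ ih
  refine ⟨fun k => c (nxt^[k] v), substApply_eq_of_unfold hσ (fun k => nxt^[k] v) _ fun k => ?_⟩
  simp only [Function.iterate_succ_apply']
  exact h2 _ (hmem k)

lemma suffix_gt_of_true {a z : ℕ → Bool} (h0 : lexLt a z)
    (h : ∀ k, z k = true → lexLt a (shiftW (k + 1) z)) (k : ℕ) : lexLt a (shiftW k z) := by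
  induction k with
  | zero => exact h0
  | succ k ih =>
    cases hk : z k
    · rw [shiftW_eq_consB, hk] at ih
      exact ih.trans_le (consB_false_lexLe _)
    · exact h k hk

lemma suffix_lt_of_false {b z : ℕ → Bool} (h0 : lexLt z b)
    (h : ∀ k, z k = false → lexLt (shiftW (k + 1) z) b) (k : ℕ) : lexLt (shiftW k z) b := by
  induction k with
  | zero => exact h0
  | succ k ih =>
    cases hk : z k
    · exact h k hk
    · rw [shiftW_eq_consB, hk] at ih
      exact (lexLe_consB_true _).trans_lt ih

lemma exists_true_false_or (y : ℕ → Bool) :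
    (∃ k, y k = true ∧ y (k + 1) = false) ∨ ∃ k, shiftW k y ∈ ({w0bar, w1bar} : Set _) := by
  by_cases h : ∃ k, y k = true ∧ y (k + 1) = false
  · exact Or.inl h
  right
  push Not at h
  by_cases h1 : ∃ k, y k = true
  · obtain ⟨k, hk⟩ := h1
    refine ⟨k, Or.inr ?_⟩
    funext i
    induction i with
    | zero => simpa [shiftW, w1bar] using hk
    | succ i ih =>
      have := h (i + k) ih
      simpa [shiftW, w1bar, Nat.add_right_comm] using this
  · push Not at h1
    exact ⟨0, Or.inl (by funext i; simpa [w0bar] using h1 i)⟩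

lemma shiftW_mem_betweenSet {a b v : ℕ → Bool} (hv : v ∈ betweenSet a b) (j : ℕ) :
    shiftW j v ∈ betweenSet a b := fun k => by simpa using hv (k + j)

lemma betweenSet_substApply {σ : Bool → List Bool} (hσ : ∀ b, σ b ≠ []) {a b y : ℕ → Bool}
    (hy : substApply σ y ∈ betweenSet a b) (k : ℕ) :
    substApply σ (shiftW k y) ∈ betweenSet a b := by
  obtain ⟨j, hj⟩ := exists_shiftW_substApply hσ y k
  rw [← hj]
  exact shiftW_mem_betweenSet hy j

lemma betweenSet_Lsub_countable {a b : ℕ → Bool} (hb : b 0 = true)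
    (h : (betweenSet a b).Countable) :
    (betweenSet (substApply Lsub a) (shiftW 1 (substApply Lsub b))).Countable := by
  refine (countable_shiftW_mem (h.image (substApply Lsub))).mono fun v hv => ?_
  set B := shiftW 1 (substApply Lsub b) with hB
  obtain ⟨x, hx⟩ : ∃ x, B = consB true (consB false x) := by
    rw [hB, eq_consB_of_head hb, substApply_Lsub_true, shiftW_one_consB,
      eq_consB_of_head (substApply_Lsub_zero (shiftW 1 b))]
    exact ⟨_, rfl⟩
  have main : ∀ v ∈ betweenSet (substApply Lsub a) B, v 0 = false →
      v ∈ substApply Lsub '' betweenSet a b := by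
    intro v hv h0
    obtain ⟨y, rfl⟩ := exists_substApply_of_parse Lsub_ne_nil
      (P := {v | v ∈ betweenSet (substApply Lsub a) B ∧ v 0 = false}) (by
        rintro v ⟨hv, h0⟩
        cases h1 : v 1
        · refine ⟨false, shiftW 1 v, ⟨shiftW_mem_betweenSet hv 1, by simpa using h1⟩, ?_⟩
          simpa [Lsub, appendW_cons, appendW_nil] using eq_consB_of_head h0
        · have h2 : v 2 = false := by
            have := (hv 1).2
            by_contra h2
            rw [hx, shiftW_eq_consB, h1, lexLt_consB_same, shiftW_eq_consB,
              Bool.eq_true_of_not_eq_false h2] at this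
            exact not_lexLt_consB_true_false _ _ this
          refine ⟨true, shiftW 2 v, ⟨shiftW_mem_betweenSet hv 2, by simpa using h2⟩, ?_⟩
          simp only [Lsub, if_true, appendW_cons, appendW_nil]
          rw [← h1, ← h0, ← shiftW_eq_consB, consB_head_tail]) (show v ∈ _ from ⟨hv, h0⟩)
    refine ⟨y, fun k => ?_, rfl⟩
    have hk := betweenSet_substApply Lsub_ne_nil hv k
    refine ⟨(substApply_lexLt_iff Lsub_ne_nil Lsub_letters).1 (hk 0).1, ?_⟩
    cases hyk : y k
    · exact lexLt_of_head (by simpa using hyk) hb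
    · have h1 := (hk 1).2
      rw [shiftW_eq_consB k, hyk, substApply_Lsub_true, shiftW_one_consB, hB,
        eq_consB_of_head hb, substApply_Lsub_true, shiftW_one_consB, lexLt_consB_same,
        substApply_lexLt_iff Lsub_ne_nil Lsub_letters] at h1
      rw [shiftW_eq_consB k, hyk, eq_consB_of_head hb, lexLt_consB_same]
      exact h1
  cases h0 : v 0
  · exact ⟨0, main v hv h0⟩
  · refine ⟨1, main _ (shiftW_mem_betweenSet hv 1) ?_⟩
    by_contra h1
    have := (hv 0).2
    rw [hx, shiftW_zero, eq_consB_of_head h0, lexLt_consB_same,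
      eq_consB_of_head (Bool.eq_true_of_not_eq_false h1)] at this
    exact not_lexLt_consB_true_false _ _ this

lemma betweenSet_Rsub_countable {a b : ℕ → Bool} (ha : a 0 = false)
    (h : (betweenSet a b).Countable) :
    (betweenSet (substApply Rsub a) (consB true (substApply Rsub b))).Countable := by
  refine ((countable_shiftW_mem h).image (substApply Rsub)).mono fun v hv => ?_
  set A := substApply Rsub a with hA
  obtain ⟨x, hx⟩ : ∃ x, A = consB false (consB true x) := by
    rw [hA, eq_consB_of_head ha, substApply_Rsub_false]
    exact ⟨_, rfl⟩
  obtain ⟨y, rfl⟩ := exists_substApply_of_parse Rsub_ne_nil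
    (P := betweenSet A (consB true (substApply Rsub b))) (by
      intro v hv
      cases h0 : v 0
      · have h1 : v 1 = true := by
          have := (hv 0).1
          by_contra h1
          rw [hx, shiftW_zero, eq_consB_of_head h0, lexLt_consB_same, shiftW_eq_consB,
            Bool.eq_false_of_not_eq_true h1] at this
          exact not_lexLt_consB_true_false _ _ this
        refine ⟨false, shiftW 2 v, shiftW_mem_betweenSet hv 2, ?_⟩
        simp only [Rsub, appendW_cons, appendW_nil, Bool.false_eq_true, if_false]
        rw [← h1, ← h0, ← shiftW_eq_consB, consB_head_tail]
      · refine ⟨true, shiftW 1 v, shiftW_mem_betweenSet hv 1, ?_⟩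
        simpa [Rsub, appendW_cons, appendW_nil] using eq_consB_of_head h0) hv
  refine ⟨y, ⟨1, fun k => ?_⟩, rfl⟩
  rw [shiftW_shiftW]
  refine ⟨(substApply_lexLt_iff Rsub_ne_nil Rsub_letters).1
    ((betweenSet_substApply Rsub_ne_nil hv (k + 1)) 0).1, ?_⟩
  have hk := betweenSet_substApply Rsub_ne_nil hv k
  rw [shiftW_eq_consB] at hk
  cases hyk : y k
  · have := (hk 1).2
    rw [hyk, substApply_Rsub_false, shiftW_one_consB, lexLt_consB_same,
      substApply_lexLt_iff Rsub_ne_nil Rsub_letters] at this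
    exact this
  · have := (hk 0).2
    rw [hyk, substApply_Rsub_true, shiftW_zero, lexLt_consB_same,
      substApply_lexLt_iff Rsub_ne_nil Rsub_letters] at this
    exact this

lemma alternating_unique {u v : ℕ → Bool} (hu : ∀ k, u (k + 1) = !u k)
    (hv : ∀ k, v (k + 1) = !v k) (h : u 0 = v 0) : u = v := by
  funext n
  induction n with
  | zero => exact h
  | succ n ih => rw [hu, hv, ih]

lemma betweenSet_Msub_countable {a b : ℕ → Bool} (hb : b 0 = true)
    (h : (betweenSet a b).Countable) :
    (betweenSet (consB false (substApply Msub a)) (consB true (substApply Msub b))).Countable := by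
  set A := substApply Msub a with hA
  set B := substApply Msub b with hB
  set Z := substApply Msub w0bar with hZ
  set Y := substApply Msub w1bar with hY
  have hZ2 : Z = consB false (consB true Z) := by
    conv_lhs => rw [hZ, eq_consB_of_head (show w0bar 0 = false from rfl), substApply_Msub_false]
    rfl
  have hY2 : Y = consB true (consB false Y) := by
    conv_lhs => rw [hY, eq_consB_of_head (show w1bar 0 = true from rfl), substApply_Msub_true]
    rfl
  have hZA : lexLe Z A := substApply_lexLe Msub_ne_nil Msub_letters (w0bar_lexLe a)
  have hBY : lexLe B Y := substApply_lexLe Msub_ne_nil Msub_letters (lexLe_w1bar b)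
  set K := betweenSet (consB false A) (consB true B) with hK
  have hlow : ∀ v ∈ K, ∀ k, v k = false → lexLt A (shiftW (k + 1) v) := by
    intro v hv k hk
    have := (hv k).1
    rwa [shiftW_eq_consB, hk, lexLt_consB_same] at this
  have hupp : ∀ v ∈ K, ∀ k, v k = true → lexLt (shiftW (k + 1) v) B := by
    intro v hv k hk
    have := (hv k).2
    rwa [shiftW_eq_consB, hk, lexLt_consB_same] at this
  set C := {y | ∃ k, shiftW k y ∈ betweenSet a b ∪ {w0bar, w1bar}} with hC
  have hCc : C.Countable := countable_shiftW_mem (h.union (by simp))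
  have main : ∀ v ∈ K, lexLt Z v → lexLt v Y → v ∈ substApply Msub '' C := by
    intro v hv hZv hvY
    obtain ⟨y, rfl⟩ := exists_substApply_of_parse Msub_ne_nil
      (P := {v | v ∈ K ∧ lexLt Z v ∧ lexLt v Y}) (by
        rintro v ⟨hv, hZv, hvY⟩
        have e2 : shiftW 2 v = shiftW 1 (shiftW 1 v) := by simp
        cases h0 : v 0
        · have h1 : v 1 = true := by
            by_contra h1
            rw [hZ2, eq_consB_of_head h0, lexLt_consB_same, shiftW_eq_consB,
              Bool.eq_false_of_not_eq_true h1] at hZv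
            exact not_lexLt_consB_true_false _ _ hZv
          have hv2 : v = consB false (consB true (shiftW 2 v)) := by
            rw [← h1, ← h0, ← shiftW_eq_consB, consB_head_tail]
          refine ⟨false, shiftW 2 v, ⟨shiftW_mem_betweenSet hv 2, ?_,
            (hupp v hv 1 h1).trans_le hBY⟩, ?_⟩
          · rw [hZ2, hv2, lexLt_consB_same, lexLt_consB_same] at hZv
            exact hZv
          · simpa [Msub, appendW_cons, appendW_nil] using hv2
        · have h1 : v 1 = false := by
            by_contra h1
            rw [hY2, eq_consB_of_head h0, lexLt_consB_same, shiftW_eq_consB,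
              Bool.eq_true_of_not_eq_false h1] at hvY
            exact not_lexLt_consB_true_false _ _ hvY
          have hv2 : v = consB true (consB false (shiftW 2 v)) := by
            rw [← h1, ← h0, ← shiftW_eq_consB, consB_head_tail]
          refine ⟨true, shiftW 2 v, ⟨shiftW_mem_betweenSet hv 2,
            hZA.trans_lt (hlow v hv 1 h1), ?_⟩, ?_⟩
          · rw [hY2, hv2, lexLt_consB_same, lexLt_consB_same] at hvY
            exact hvY
          · simpa [Msub, appendW_cons, appendW_nil] using hv2)
      (show v ∈ _ from ⟨hv, hZv, hvY⟩)
    refine ⟨y, ?_, rfl⟩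
    have hgt : ∀ k, y k = true → lexLt a (shiftW (k + 1) y) := by
      intro k hk
      have := ((betweenSet_substApply Msub_ne_nil hv k) 1).1
      rwa [shiftW_eq_consB k, hk, substApply_Msub_true, shiftW_one_consB, lexLt_consB_same,
        substApply_lexLt_iff Msub_ne_nil Msub_letters] at this
    have hlt : ∀ k, y k = false → lexLt (shiftW (k + 1) y) b := by
      intro k hk
      have := ((betweenSet_substApply Msub_ne_nil hv k) 1).2
      rwa [shiftW_eq_consB k, hk, substApply_Msub_false, shiftW_one_consB, lexLt_consB_same,
        substApply_lexLt_iff Msub_ne_nil Msub_letters] at this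
    rcases exists_true_false_or y with ⟨k, hk1, hk2⟩ | ⟨k, hk⟩
    · refine ⟨k + 1, Or.inl fun j => ⟨?_, ?_⟩⟩
      · refine suffix_gt_of_true (hgt k hk1) (fun i hi => ?_) j
        simpa [Nat.add_right_comm] using hgt (i + (k + 1)) hi
      · refine suffix_lt_of_false (lexLt_of_head (by simpa using hk2) hb) (fun i hi => ?_) j
        simpa [Nat.add_right_comm] using hlt (i + (k + 1)) hi
    · exact ⟨k, Or.inr hk⟩
  refine (countable_shiftW_mem ((hCc.image (substApply Msub)).union
    (Set.countable_insert.2 (Set.countable_singleton Y) : ({Z, Y} : Set _).Countable))).mono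
    fun v hv => ?_
  by_cases hex : ∃ k, lexLt Z (shiftW k v) ∧ lexLt (shiftW k v) Y
  · obtain ⟨k, h1, h2⟩ := hex
    exact ⟨k, Or.inl (main _ (shiftW_mem_betweenSet hv k) h1 h2)⟩
  have halt : ∀ k, v (k + 1) = !v k := by
    intro k
    by_contra hk
    refine hex ⟨k + 1, ?_⟩
    cases h0 : v k
    · rw [h0, Bool.not_false, Bool.not_eq_true] at hk
      exact ⟨hZA.trans_lt (hlow v hv k h0), by
        rw [hY2]; exact lexLt_of_head (by simpa using hk) rfl⟩
    · rw [h0, Bool.not_true, Bool.not_eq_false] at hk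
      exact ⟨by rw [hZ2]; exact lexLt_of_head rfl (by simpa using hk),
        (hupp v hv k h0).trans_le hBY⟩
  have altOf : ∀ (c : Bool) (x : ℕ → Bool), x = consB c (consB (!c) x) →
      ∀ k, x (k + 1) = !x k := by
    intro c x hx k
    have hper : ∀ k, x (k + 2) = x k := fun k => congrFun hx (k + 2)
    have h01 : x 0 = c ∧ x 1 = !c := ⟨by rw [hx]; rfl, by rw [hx]; rfl⟩
    induction k with
    | zero => rw [h01.1, h01.2]
    | succ k ih => rw [hper, ih, Bool.not_not]
  refine ⟨0, Or.inr ?_⟩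
  cases h0 : v 0
  · exact Or.inl (alternating_unique halt (altOf false Z hZ2) (by rw [hZ2]; exact h0))
  · exact Or.inr (alternating_unique halt (altOf true Y hY2) (by rw [hY2]; exact h0))

/-! ### Transport of bounds along compositions of `L`, `M`, `R` -/

/-- `S` is a map on words, such as the action of an element of `{L,M,R}*`, and `α`, `β` transport
lower and upper bounds for suffixes; `N` is the number of letters gained by `α`. -/
structure BoundTransport (S α β : (ℕ → Bool) → ℕ → Bool) (N : ℕ) : Prop where
  lower_head : ∀ a, a 0 = false → α a 0 = false
  upper_head : ∀ b, b 0 = true → β b 0 = true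
  countable : ∀ a b, a 0 = false → b 0 = true → (betweenSet a b).Countable →
    (betweenSet (α a) (β b)).Countable
  bounds : ∀ a b u, a 0 = false → b 0 = true → SuffixBounds a b u →
    SuffixBounds (α a) (β b) (S u)
  lower_mem : ∀ a u, consB true a ∈ orbit u → consB true (α a) ∈ orbit (S u)
  upper_mem : ∀ b u, b 0 = true → consB false b ∈ orbit u → consB false (β b) ∈ orbit (S u)
  lower_agree : ∀ a a' n, a 0 = false → a' 0 = false → Agree (n + 1) a a' →
    Agree (n + 1 + N) (α a) (α a')

lemma BoundTransport.id : BoundTransport id id id 0 := by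
  constructor <;> intros <;> assumption

lemma BoundTransport.comp {S α β S' α' β' : (ℕ → Bool) → ℕ → Bool} {N N' : ℕ}
    (h : BoundTransport S α β N) (h' : BoundTransport S' α' β' N') :
    BoundTransport (S ∘ S') (α ∘ α') (β ∘ β') (N' + N) where
  lower_head a ha := h.lower_head _ (h'.lower_head _ ha)
  upper_head b hb := h.upper_head _ (h'.upper_head _ hb)
  countable a b ha hb hc := h.countable _ _ (h'.lower_head _ ha) (h'.upper_head _ hb)
    (h'.countable _ _ ha hb hc)
  bounds a b u ha hb hc := h.bounds _ _ _ (h'.lower_head _ ha) (h'.upper_head _ hb)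
    (h'.bounds _ _ _ ha hb hc)
  lower_mem a u hu := h.lower_mem _ _ (h'.lower_mem _ _ hu)
  upper_mem b u hb hu := h.upper_mem _ _ (h'.upper_head _ hb) (h'.upper_mem _ _ hb hu)
  lower_agree a a' n ha ha' hn := by
    have h1 := h'.lower_agree a a' n ha ha' hn
    have h2 := h.lower_agree _ _ (n + N') (h'.lower_head _ ha) (h'.lower_head _ ha')
      (h1.mono (by omega))
    exact h2.mono (by omega)

lemma SuffixBounds.tail {a b u : ℕ → Bool} (h : SuffixBounds a b u) :
    SuffixBounds a b (shiftW 1 u) := fun k => by simpa using h (k + 1)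

lemma orbit_trans {u v w : ℕ → Bool} (h : u ∈ orbit v) (h' : v ∈ orbit w) : u ∈ orbit w := by
  obtain ⟨i, rfl⟩ := h
  obtain ⟨j, rfl⟩ := h'
  exact ⟨i + j, by funext n; simp only [Nat.add_assoc]⟩

lemma substApply_mem_orbit {σ : Bool → List Bool} (hσ : ∀ b, σ b ≠ []) {x u : ℕ → Bool}
    (h : x ∈ orbit u) : substApply σ x ∈ orbit (substApply σ u) := by
  obtain ⟨k, rfl⟩ := h
  obtain ⟨j, hj⟩ := exists_shiftW_substApply hσ u k
  exact ⟨j, hj.symm⟩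

/-- Bounds for the suffixes of `σ(u)` follow from bounds for those starting in the first block. -/
lemma suffixBounds_substApply {σ : Bool → List Bool} (hσ : ∀ b, σ b ≠ []) {a b a' b' : ℕ → Bool}
    (h : ∀ u, SuffixBounds a b u → ∀ j, j < (σ (u 0)).length →
      lexLe a' (shiftW j (substApply σ u)) ∧ lexLe (shiftW j (substApply σ u)) b')
    {u : ℕ → Bool} (hu : SuffixBounds a b u) : SuffixBounds a' b' (substApply σ u) := by
  intro n
  induction n using Nat.strong_induction_on generalizing u with
  | _ n ih =>
    by_cases hn : n < (σ (u 0)).length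
    · exact h u hu n hn
    · have hpos := List.length_pos_of_ne_nil (hσ (u 0))
      have h1 := ih (n - (σ (u 0)).length) (by omega) hu.tail
      have h2 : shiftW n (substApply σ u) =
          shiftW (n - (σ (u 0)).length) (substApply σ (shiftW 1 u)) := by
        rw [substApply_unfold hσ u]
        funext i
        have : ¬ i + n < (σ (u 0)).length := by omega
        simp only [shiftW_apply, appendW, this, if_false]
        congr 1
        omega
      rw [h2]
      exact h1

lemma lexLe_of_head {u v : ℕ → Bool} (hu : u 0 = false) (hv : v 0 = true) : lexLe u v :=
  Or.inl (lexLt_of_head hu hv)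

lemma boundTransport_Lsub : BoundTransport (substApply Lsub) (substApply Lsub)
    (fun b => shiftW 1 (substApply Lsub b)) 1 where
  lower_head a _ := substApply_Lsub_zero a
  upper_head b hb := by rw [eq_consB_of_head hb]; simp
  countable a b _ hb h := betweenSet_Lsub_countable hb h
  bounds a b u ha hb hu := by
    refine suffixBounds_substApply Lsub_ne_nil (a := a) (b := b) (fun u hu j hj => ?_) hu
    have hb' : shiftW 1 (substApply Lsub b) = consB true (substApply Lsub (shiftW 1 b)) := by
      conv_lhs => rw [eq_consB_of_head hb]
      simp
    match j with
    | 0 => exact ⟨substApply_lexLe Lsub_ne_nil Lsub_letters (hu 0).1,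
        lexLe_of_head (substApply_Lsub_zero u) (by rw [hb']; rfl)⟩
    | 1 =>
      cases h0 : u 0
      · simp [h0, Lsub] at hj
      · rw [eq_consB_of_head h0, hb']
        simp only [substApply_Lsub_true, shiftW_one_consB]
        refine ⟨lexLe_of_head (substApply_Lsub_zero a) rfl, ?_⟩
        rw [lexLe_consB_same]
        refine substApply_lexLe Lsub_ne_nil Lsub_letters ?_
        have := (hu 0).2
        rwa [shiftW_zero, eq_consB_of_head h0, eq_consB_of_head hb, lexLe_consB_same] at this
    | j + 2 => cases h0 : u 0 <;> simp [h0, Lsub] at hj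
  lower_mem a u h := by
    refine orbit_trans ⟨1, ?_⟩ (substApply_mem_orbit Lsub_ne_nil h)
    rw [substApply_Lsub_true]; rfl
  upper_mem b u hb h := by
    refine orbit_trans ⟨1, ?_⟩ (substApply_mem_orbit Lsub_ne_nil h)
    rw [eq_consB_of_head hb]
    simp only [substApply_Lsub_true, substApply_Lsub_false, shiftW_one_consB]
    rfl
  lower_agree a a' n _ _ h := h.substApply_Lsub

lemma boundTransport_Msub : BoundTransport (substApply Msub)
    (fun a => consB false (substApply Msub a)) (fun b => consB true (substApply Msub b)) 1 where
  lower_head _ _ := rfl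
  upper_head _ _ := rfl
  countable a b _ hb h := betweenSet_Msub_countable hb h
  bounds a b u ha hb hu := by
    refine suffixBounds_substApply Msub_ne_nil (a := a) (b := b) (fun u hu j hj => ?_) hu
    have ha' : substApply Msub a = consB false (consB true (substApply Msub (shiftW 1 a))) := by
      conv_lhs => rw [eq_consB_of_head ha]
      simp
    have hb' : substApply Msub b = consB true (consB false (substApply Msub (shiftW 1 b))) := by
      conv_lhs => rw [eq_consB_of_head hb]
      simp
    have h1 := (hu 1)
    match j with
    | 0 =>
      cases h0 : u 0 <;> rw [eq_consB_of_head h0]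
      · simp only [substApply_Msub_false, shiftW_zero]
        exact ⟨by rw [ha', lexLe_consB_same]; exact lexLe_of_head rfl rfl,
          lexLe_of_head rfl rfl⟩
      · simp only [substApply_Msub_true, shiftW_zero]
        exact ⟨lexLe_of_head rfl rfl, by
          rw [hb', lexLe_consB_same]; exact lexLe_of_head rfl rfl⟩
    | 1 =>
      cases h0 : u 0 <;> rw [eq_consB_of_head h0]
      · simp only [substApply_Msub_false, shiftW_one_consB]
        exact ⟨lexLe_of_head rfl rfl, by
          rw [lexLe_consB_same]; exact substApply_lexLe Msub_ne_nil Msub_letters h1.2⟩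
      · simp only [substApply_Msub_true, shiftW_one_consB]
        exact ⟨by rw [lexLe_consB_same]; exact substApply_lexLe Msub_ne_nil Msub_letters h1.1,
          lexLe_of_head rfl rfl⟩
    | j + 2 => cases h0 : u 0 <;> simp [h0, Msub] at hj
  lower_mem a u h := by
    have := substApply_mem_orbit Msub_ne_nil h
    rwa [substApply_Msub_true] at this
  upper_mem b u hb h := by
    have := substApply_mem_orbit Msub_ne_nil h
    rwa [substApply_Msub_false] at this
  lower_agree a a' n _ _ h := (h.substApply Msub_ne_nil).consB false

lemma boundTransport_Rsub : BoundTransport (substApply Rsub)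
    (substApply Rsub) (fun b => consB true (substApply Rsub b)) 1 where
  lower_head a ha := by rw [eq_consB_of_head ha]; simp
  upper_head _ _ := rfl
  countable a b ha _ h := betweenSet_Rsub_countable ha h
  bounds a b u ha hb hu := by
    refine suffixBounds_substApply Rsub_ne_nil (a := a) (b := b) (fun u hu j hj => ?_) hu
    have ha' : substApply Rsub a 0 = false := by rw [eq_consB_of_head ha]; simp
    have h1 := substApply_lexLe Rsub_ne_nil Rsub_letters (hu 1).2
    match j with
    | 0 =>
      refine ⟨substApply_lexLe Rsub_ne_nil Rsub_letters (hu 0).1, ?_⟩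
      cases h0 : u 0 <;> rw [eq_consB_of_head h0]
      · simp only [substApply_Rsub_false, shiftW_zero]
        exact lexLe_of_head rfl rfl
      · simp only [substApply_Rsub_true, shiftW_zero]
        rw [lexLe_consB_same]
        exact h1
    | 1 =>
      cases h0 : u 0
      · rw [eq_consB_of_head h0]
        simp only [substApply_Rsub_false, shiftW_one_consB]
        refine ⟨lexLe_of_head ha' rfl, ?_⟩
        rw [lexLe_consB_same]
        exact h1
      · simp [h0, Rsub] at hj
    | j + 2 => cases h0 : u 0 <;> simp [h0, Rsub] at hj
  lower_mem a u h := by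
    have := substApply_mem_orbit Rsub_ne_nil h
    rwa [substApply_Rsub_true] at this
  upper_mem b u hb h := by
    have := substApply_mem_orbit Rsub_ne_nil h
    rwa [substApply_Rsub_false] at this
  lower_agree a a' n ha ha' h := by
    rw [eq_consB_of_head ha, eq_consB_of_head ha']
    simpa using ((h.tail.substApply Rsub_ne_nil).consB true).consB false

lemma exists_boundTransport_letter {τ : Bool → List Bool}
    (hτ : τ = Lsub ∨ τ = Msub ∨ τ = Rsub) :
    (∀ b, τ b ≠ []) ∧ ∃ α β, BoundTransport (substApply τ) α β 1 := by
  rcases hτ with rfl | rfl | rfl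
  · exact ⟨Lsub_ne_nil, _, _, boundTransport_Lsub⟩
  · exact ⟨Msub_ne_nil, _, _, boundTransport_Msub⟩
  · exact ⟨Rsub_ne_nil, _, _, boundTransport_Rsub⟩

lemma exists_boundTransport_of_mem_LMRstar {σ : Bool → List Bool} (hσ : σ ∈ LMRstar) :
    ∃ α β N, BoundTransport (substApply σ) α β N := by
  obtain ⟨l, hl, rfl⟩ := hσ
  suffices h : (∀ b, l.foldr compSub idSub b ≠ []) ∧
      ∃ α β N, BoundTransport (substApply (l.foldr compSub idSub)) α β N from h.2
  induction l with
  | nil =>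
    have : substApply idSub = id := funext substApply_idSub
    exact ⟨by simp [idSub], id, id, 0, by simpa [this] using BoundTransport.id⟩
  | cons τ l ih =>
    obtain ⟨h1, α, β, N, h2⟩ := ih fun τ' hτ' => hl τ' (List.mem_cons_of_mem _ hτ')
    obtain ⟨h3, α', β', h4⟩ := exists_boundTransport_letter (hl τ List.mem_cons_self)
    have : substApply ((τ :: l).foldr compSub idSub) =
        substApply τ ∘ substApply (l.foldr compSub idSub) :=
      funext fun u => substApply_compSub h3 h1 u
    exact ⟨compSub_ne_nil h3 h1, α' ∘ α, β' ∘ β, N + 1, by rw [this]; exact h4.comp h2⟩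

lemma exists_boundTransport_of_limitWord {σseq : ℕ → Bool → List Bool}
    (hσ : ∀ n, σseq n = Lsub ∨ σseq n = Msub ∨ σseq n = Rsub) {u : ℕ → Bool}
    (hu : IsLimitWord σseq u) (N : ℕ) :
    ∃ S α β v, BoundTransport S α β N ∧ u = S v := by
  obtain ⟨useq, rfl, h⟩ := hu
  suffices H : ∃ S α β, BoundTransport S α β N ∧ useq 0 = S (useq N) by
    obtain ⟨S, α, β, h1, h2⟩ := H
    exact ⟨S, α, β, _, h1, h2⟩
  induction N with
  | zero => exact ⟨_, _, _, BoundTransport.id, rfl⟩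
  | succ N ih =>
    obtain ⟨S, α, β, h1, h2⟩ := ih
    obtain ⟨-, α', β', h4⟩ := exists_boundTransport_letter (hσ N)
    have h5 := h1.comp h4
    rw [Nat.add_comm] at h5
    exact ⟨_, _, _, h5, by rw [h2, h N]; rfl⟩

/-! ### Suprema and infima of orbits -/

lemma lexSupSeq_apply (S : Set (ℕ → Bool)) (n : ℕ) :
    lexSupSeq S n = true ↔ ∃ u ∈ S, (∀ i, i < n → u i = lexSupSeq S i) ∧ u n = true := by
  rw [lexSupSeq]; simp

lemma lexInfSeq_apply (S : Set (ℕ → Bool)) (n : ℕ) :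
    lexInfSeq S n = false ↔ ∃ u ∈ S, (∀ i, i < n → u i = lexInfSeq S i) ∧ u n = false := by
  rw [lexInfSeq]; simp

lemma lexLe_lexSupSeq {S : Set (ℕ → Bool)} {u : ℕ → Bool} (hu : u ∈ S) :
    lexLe u (lexSupSeq S) := by
  rw [← not_lexLt]
  rintro ⟨n, h1, h2⟩
  rw [Bool.lt_iff] at h2
  have := (lexSupSeq_apply S n).2 ⟨u, hu, fun i hi => (h1 i hi).symm, h2.2⟩
  rw [h2.1] at this
  exact Bool.false_ne_true this

lemma lexInfSeq_lexLe {S : Set (ℕ → Bool)} {u : ℕ → Bool} (hu : u ∈ S) :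
    lexLe (lexInfSeq S) u := by
  rw [← not_lexLt]
  rintro ⟨n, h1, h2⟩
  rw [Bool.lt_iff] at h2
  have := (lexInfSeq_apply S n).2 ⟨u, hu, h1, h2.1⟩
  rw [h2.2] at this
  exact Bool.false_ne_true this.symm

lemma exists_agree_lexSupSeq {S : Set (ℕ → Bool)} (hS : S.Nonempty) (n : ℕ) :
    ∃ u ∈ S, Agree n u (lexSupSeq S) := by
  induction n with
  | zero => exact ⟨_, hS.some_mem, fun i hi => by omega⟩
  | succ n ih =>
    have step : ∀ u ∈ S, Agree n u (lexSupSeq S) → u n = lexSupSeq S n →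
        ∃ u ∈ S, Agree (n + 1) u (lexSupSeq S) := fun u hu h hn =>
      ⟨u, hu, fun i hi => by
        rcases Nat.lt_succ_iff_lt_or_eq.1 hi with hi | rfl
        · exact h i hi
        · exact hn⟩
    cases h : lexSupSeq S n
    · obtain ⟨u, hu, hun⟩ := ih
      refine step u hu hun ?_
      rw [h]
      by_contra h0
      rw [(lexSupSeq_apply S n).2 ⟨u, hu, hun, Bool.eq_true_of_not_eq_false h0⟩] at h
      exact Bool.false_ne_true h.symm
    · obtain ⟨u, hu, hun, h0⟩ := (lexSupSeq_apply S n).1 h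
      exact step u hu hun (h0.trans h.symm)

lemma exists_agree_lexInfSeq {S : Set (ℕ → Bool)} (hS : S.Nonempty) (n : ℕ) :
    ∃ u ∈ S, Agree n u (lexInfSeq S) := by
  induction n with
  | zero => exact ⟨_, hS.some_mem, fun i hi => by omega⟩
  | succ n ih =>
    have step : ∀ u ∈ S, Agree n u (lexInfSeq S) → u n = lexInfSeq S n →
        ∃ u ∈ S, Agree (n + 1) u (lexInfSeq S) := fun u hu h hn =>
      ⟨u, hu, fun i hi => by
        rcases Nat.lt_succ_iff_lt_or_eq.1 hi with hi | rfl
        · exact h i hi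
        · exact hn⟩
    cases h : lexInfSeq S n
    · obtain ⟨u, hu, hun, h0⟩ := (lexInfSeq_apply S n).1 h
      exact step u hu hun (h0.trans h.symm)
    · obtain ⟨u, hu, hun⟩ := ih
      refine step u hu hun ?_
      rw [h]
      by_contra h0
      rw [(lexInfSeq_apply S n).2 ⟨u, hu, hun, Bool.eq_false_of_not_eq_true h0⟩] at h
      exact Bool.false_ne_true h

lemma SuffixBounds.supO_lexLe {a b u : ℕ → Bool} (h : SuffixBounds a b u) :
    lexLe (supO u) b := by
  rw [← not_lexLt]
  rintro ⟨n, h1, h2⟩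
  obtain ⟨v, ⟨k, rfl⟩, hv⟩ := exists_agree_lexSupSeq ⟨u, shiftW_mem_orbit 0 u⟩ (n + 1)
  exact not_lexLt.2 (h k).2
    ⟨n, fun i hi => (h1 i hi).trans (hv i (by omega)).symm, h2.trans_eq (hv n (by omega)).symm⟩

lemma SuffixBounds.lexLe_infO {a b u : ℕ → Bool} (h : SuffixBounds a b u) :
    lexLe a (infO u) := by
  rw [← not_lexLt]
  rintro ⟨n, h1, h2⟩
  obtain ⟨v, ⟨k, rfl⟩, hv⟩ := exists_agree_lexInfSeq ⟨u, shiftW_mem_orbit 0 u⟩ (n + 1)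
  exact not_lexLt.2 (h k).1
    ⟨n, fun i hi => (hv i (by omega)).trans (h1 i hi), (hv n (by omega)).trans_lt h2⟩

lemma mem_orbit_of_consB {c : Bool} {a u : ℕ → Bool} (h : consB c a ∈ orbit u) : a ∈ orbit u :=
  orbit_trans ⟨1, rfl⟩ h

lemma SuffixBounds.infO_eq {a b u : ℕ → Bool} (h : SuffixBounds a b u) (ha : a ∈ orbit u) :
    infO u = a :=
  lexLe_antisymm (lexInfSeq_lexLe ha) h.lexLe_infO

lemma SuffixBounds.supO_eq {a b u : ℕ → Bool} (h : SuffixBounds a b u) (hb : b ∈ orbit u) :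
    supO u = b :=
  lexLe_antisymm h.supO_lexLe (lexLe_lexSupSeq hb)

/-! ### Base words -/

lemma w10bar_eq : w10bar = consB true w0bar := by
  funext n; cases n <;> simp [w10bar, w0bar]

lemma w01bar_eq : w01bar = consB false w1bar := by
  funext n; cases n <;> simp [w01bar, w1bar]

lemma w010bar_eq : w010bar = consB false w10bar := by
  funext n; cases n <;> simp [w010bar, w10bar]

lemma w101bar_eq : w101bar = consB true w01bar := by
  funext n; cases n <;> simp [w101bar, w01bar]

lemma suffixBounds_w10bar : SuffixBounds w0bar w10bar w10bar := by
  intro k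
  refine ⟨w0bar_lexLe _, ?_⟩
  cases k with
  | zero => exact lexLe_refl _
  | succ k => rw [w10bar_eq]; exact lexLe_of_head rfl rfl

lemma suffixBounds_w010bar : SuffixBounds w0bar w10bar w010bar := by
  intro k
  refine ⟨w0bar_lexLe _, ?_⟩
  cases k with
  | zero => exact lexLe_of_head rfl rfl
  | succ k => rw [w010bar_eq]; exact (suffixBounds_w10bar k).2

lemma suffixBounds_w01bar : SuffixBounds w01bar w1bar w01bar := by
  intro k
  refine ⟨?_, lexLe_w1bar _⟩
  cases k with
  | zero => exact lexLe_refl _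
  | succ k => rw [w01bar_eq]; exact lexLe_of_head rfl rfl

lemma suffixBounds_w101bar : SuffixBounds w01bar w1bar w101bar := by
  intro k
  refine ⟨?_, lexLe_w1bar _⟩
  cases k with
  | zero => exact lexLe_of_head rfl rfl
  | succ k => rw [w101bar_eq]; exact (suffixBounds_w01bar k).1

lemma betweenSet_w0bar_w10bar_countable : (betweenSet w0bar w10bar).Countable := by
  refine Set.countable_empty.mono fun v hv => ?_
  have h : v = w0bar := by
    funext k
    by_contra hk
    have hk' : v k = true := by simpa [w0bar] using hk
    have := (hv k).2
    rw [w10bar_eq, shiftW_eq_consB, hk', lexLt_consB_same] at this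
    exact not_lexLt.2 (w0bar_lexLe _) this
  exact lexLt_irrefl _ (h ▸ (hv 0).1)

lemma betweenSet_w01bar_w1bar_countable : (betweenSet w01bar w1bar).Countable := by
  refine Set.countable_empty.mono fun v hv => ?_
  have h : v = w1bar := by
    funext k
    by_contra hk
    have hk' : v k = false := by simpa [w1bar] using hk
    have := (hv k).1
    rw [w01bar_eq, shiftW_eq_consB, hk', lexLt_consB_same] at this
    exact not_lexLt.2 (lexLe_w1bar _) this
  exact lexLt_irrefl _ (h ▸ (hv 0).2)

/-! ### Values of digit sequences -/

lemma hasSum_one_div_pow {β : ℝ} (hβ : 1 < β) :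
    HasSum (fun k : ℕ => 1 / β ^ (k + 1)) (1 / (β - 1)) := by
  have h0 : (0 : ℝ) < β := by linarith
  have h := (hasSum_geometric_of_lt_one (inv_nonneg.2 h0.le) (inv_lt_one_of_one_lt₀ hβ)).mul_left
    β⁻¹
  have h1 : (β⁻¹ * (1 - β⁻¹)⁻¹ : ℝ) = 1 / (β - 1) := by
    have : β - 1 ≠ 0 := by linarith
    field_simp
  rw [h1] at h
  have h2 : (fun k : ℕ => 1 / β ^ (k + 1)) = fun k => β⁻¹ * β⁻¹ ^ k := by
    funext k
    rw [inv_pow, pow_succ, one_div, mul_inv, mul_comm]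
  rw [h2]
  exact h

lemma summable_piR {β C : ℝ} (hβ : 1 < β) {d : ℕ → ℝ} (hd : ∀ k, |d k| ≤ C) :
    Summable fun k => d k / β ^ (k + 1) := by
  have h0 : (0 : ℝ) < β := by linarith
  refine Summable.of_norm_bounded ((hasSum_one_div_pow hβ).summable.mul_left C) fun k => ?_
  rw [Real.norm_eq_abs, abs_div, abs_of_pos (pow_pos h0 _), mul_one_div]
  gcongr
  exact hd k

lemma piR_split {β C : ℝ} (hβ : 1 < β) {d : ℕ → ℝ} (hd : ∀ k, |d k| ≤ C) (k : ℕ) :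
    piR β d = ∑ i ∈ Finset.range k, d i / β ^ (i + 1) +
      piR β (fun i => d (i + k)) / β ^ k := by
  have h0 : (0 : ℝ) < β := by linarith
  rw [piR, ← (summable_piR hβ hd).sum_add_tsum_nat_add k, piR, ← tsum_div_const]
  congr 1
  refine tsum_congr fun i => ?_
  rw [div_div, ← pow_add]
  congr 2
  ring

lemma piR_head {β C : ℝ} (hβ : 1 < β) {d : ℕ → ℝ} (hd : ∀ k, |d k| ≤ C) :
    piR β d = (d 0 + piR β (fun i => d (i + 1))) / β := by
  rw [piR_split hβ hd 1]
  simp [add_div]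

lemma abs_bR_le (u : ℕ → Bool) (k : ℕ) : |bR u k| ≤ 1 := by
  simp only [bR]; split_ifs <;> simp

lemma piR_bR (β : ℝ) (u : ℕ → Bool) : piR β (bR u) = piB β u := rfl

lemma bR_shiftW (u : ℕ → Bool) (k : ℕ) : (fun i => bR u (i + k)) = bR (shiftW k u) := rfl

lemma summable_piB {β : ℝ} (hβ : 1 < β) (u : ℕ → Bool) :
    Summable fun k => (if u k then (1 : ℝ) else 0) / β ^ (k + 1) :=
  summable_piR hβ (abs_bR_le u)

lemma piB_nonneg {β : ℝ} (hβ : 0 ≤ β) (u : ℕ → Bool) : 0 ≤ piB β u :=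
  tsum_nonneg fun k => div_nonneg (by split_ifs <;> simp) (pow_nonneg hβ _)

lemma piB_le {β : ℝ} (hβ : 1 < β) (u : ℕ → Bool) : piB β u ≤ 1 / (β - 1) := by
  have h0 : (0 : ℝ) < β := by linarith
  refine (summable_piB hβ u).tsum_le_of_sum_le fun s => ?_
  refine le_trans (Finset.sum_le_sum fun k _ => ?_)
    ((hasSum_one_div_pow hβ).summable.sum_le_tsum s fun k _ => by positivity) |>.trans_eq
    (hasSum_one_div_pow hβ).tsum_eq
  gcongr
  split_ifs <;> simp

lemma piB_head {β : ℝ} (hβ : 1 < β) (u : ℕ → Bool) :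
    piB β u = ((if u 0 then 1 else 0) + piB β (shiftW 1 u)) / β :=
  piR_head hβ (abs_bR_le u)

lemma piB_sub_of_agree {β : ℝ} (hβ : 1 < β) {n : ℕ} {u v : ℕ → Bool} (h : Agree n u v) :
    piB β u - piB β v = (piB β (shiftW n u) - piB β (shiftW n v)) / β ^ n := by
  rw [← piR_bR, ← piR_bR, piR_split hβ (abs_bR_le u) n, piR_split hβ (abs_bR_le v) n,
    bR_shiftW, bR_shiftW, piR_bR, piR_bR, sub_div]
  have : ∑ i ∈ Finset.range n, bR u i / β ^ (i + 1) = ∑ i ∈ Finset.range n, bR v i / β ^ (i + 1) :=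
    Finset.sum_congr rfl fun i hi => by simp only [bR, h i (Finset.mem_range.1 hi)]
  rw [this]
  ring

lemma piB_lt_of_agree_of_lt {β : ℝ} (hβ : 1 < β) {n : ℕ} {u v : ℕ → Bool} (h : Agree n u v)
    (hu : u n = false) (hv : v n = true)
    (hlt : piB β (shiftW (n + 1) u) < 1 + piB β (shiftW (n + 1) v)) : piB β u < piB β v := by
  have h0 : (0 : ℝ) < β := by linarith
  have h1 := piB_sub_of_agree hβ h
  rw [piB_head hβ (shiftW n u), piB_head hβ (shiftW n v)] at h1
  simp only [shiftW_apply_zero, hu, hv, shiftW_shiftW, if_true, Bool.false_eq_true, if_false,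
    Nat.add_comm 1 n] at h1
  rw [← sub_neg, h1, ← sub_div]
  exact div_neg_of_neg_of_pos (div_neg_of_neg_of_pos (by linarith) h0) (pow_pos h0 _)

lemma agree_or_exists_first_ne (N : ℕ) (u v : ℕ → Bool) :
    Agree N u v ∨ ∃ n < N, Agree n u v ∧ u n ≠ v n := by
  induction N with
  | zero => exact Or.inl fun i hi => by omega
  | succ N ih =>
    rcases ih with h | ⟨n, hn, h⟩
    · by_cases hN : u N = v N
      · refine Or.inl fun i hi => ?_
        rcases Nat.lt_succ_iff_lt_or_eq.1 hi with hi | rfl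
        · exact h i hi
        · exact hN
      · exact Or.inr ⟨N, by omega, h, hN⟩
    · exact Or.inr ⟨n, by omega, h⟩

/-- `u` is smaller than `v` and differs from it within the first `N` letters. -/
def PrefixLt (N : ℕ) (u v : ℕ → Bool) : Prop := ∃ n < N, Agree n u v ∧ u n < v n

lemma PrefixLt.lexLt {N : ℕ} {u v : ℕ → Bool} (h : PrefixLt N u v) : lexLt u v := by
  obtain ⟨n, -, h1, h2⟩ := h
  exact ⟨n, h1, h2⟩

lemma PrefixLt.agree_left {N : ℕ} {u u' v : ℕ → Bool} (h : PrefixLt N u v)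
    (hu : Agree N u' u) : PrefixLt N u' v := by
  obtain ⟨n, hn, h1, h2⟩ := h
  exact ⟨n, hn, fun i hi => (hu i (by omega)).trans (h1 i hi), (hu n hn).trans_lt h2⟩

lemma PrefixLt.agree_right {N : ℕ} {u v v' : ℕ → Bool} (h : PrefixLt N u v)
    (hv : Agree N v v') : PrefixLt N u v' := by
  obtain ⟨n, hn, h1, h2⟩ := h
  exact ⟨n, hn, fun i hi => (h1 i hi).trans (hv i (by omega)), h2.trans_eq (hv n hn)⟩

lemma not_prefixLt {N : ℕ} {u v : ℕ → Bool} (h : ¬ PrefixLt N u v) :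
    Agree N u v ∨ ∃ n < N, Agree n v u ∧ v n = false ∧ u n = true := by
  rcases agree_or_exists_first_ne N u v with h1 | ⟨n, hn, h1, h2⟩
  · exact Or.inl h1
  · refine Or.inr ⟨n, hn, fun i hi => (h1 i hi).symm, ?_⟩
    rw [← Bool.lt_iff]
    exact lt_of_le_of_ne (not_lt.1 fun h3 => h ⟨n, hn, h1, h3⟩) h2.symm

lemma PrefixLt.lexLe_trans {N : ℕ} {u v w : ℕ → Bool} (h : PrefixLt N v w) (hu : lexLe u v) :
    PrefixLt N u w := by
  by_contra hn
  rcases not_prefixLt hn with h1 | ⟨n, -, h1, h2⟩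
  · exact lexLt_irrefl _ (hu.trans_lt (h.agree_right fun i hi => (h1 i hi).symm).lexLt)
  · exact lexLt_irrefl _ ((hu.trans_lt h.lexLt).trans ⟨n, h1, Bool.lt_iff.2 h2⟩)

lemma PrefixLt.trans_lexLe {N : ℕ} {u v w : ℕ → Bool} (h : PrefixLt N u v) (hv : lexLe v w) :
    PrefixLt N u w := by
  by_contra hn
  rcases not_prefixLt hn with h1 | ⟨n, -, h1, h2⟩
  · exact lexLt_irrefl _ ((h.agree_left fun i hi => (h1 i hi).symm).lexLt.trans_le hv)
  · exact lexLt_irrefl _ ((h.lexLt.trans_le hv).trans ⟨n, h1, Bool.lt_iff.2 h2⟩)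

lemma exists_tail_bound_lt {β ε : ℝ} (hβ : 1 < β) (hε : 0 < ε) :
    ∃ N : ℕ, 1 / (β - 1) / β ^ N < ε := by
  have h := (tendsto_inv_atTop_zero.comp (tendsto_pow_atTop_atTop_of_one_lt hβ)).const_mul
    (1 / (β - 1))
  rw [mul_zero] at h
  obtain ⟨N, hN⟩ := (h.eventually (gt_mem_nhds hε)).exists
  exact ⟨N, by simpa [div_eq_mul_inv] using hN⟩

lemma piB_sub_le_of_agree {β : ℝ} (hβ : 1 < β) {N : ℕ} {u v : ℕ → Bool} (h : Agree N u v) :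
    piB β u - piB β v ≤ 1 / (β - 1) / β ^ N := by
  have h0 : (0 : ℝ) < β := by linarith
  rw [piB_sub_of_agree hβ h]
  gcongr
  have := piB_le hβ (shiftW N u)
  have := piB_nonneg h0.le (shiftW N v)
  linarith

/-! ### Unique expansions -/

lemma exists_expansion {β m x : ℝ} (hβ : 1 < β) (hm : 1 < m) (hm2 : m ≤ 2) (hβm : β ≤ 1 + m)
    (hx0 : 0 ≤ x) (hx1 : x ≤ m / (β - 1)) :
    ∃ d : ℕ → ℝ, (∀ k, d k ∈ ({0, 1, m} : Set ℝ)) ∧ piR β d = x := by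
  have h0 : (0 : ℝ) < β := by linarith
  have hβ1 : 0 < β - 1 := by linarith
  have hstep : ∀ y : ℝ, ∃ c, 0 ≤ y ∧ y ≤ m / (β - 1) →
      c ∈ ({0, 1, m} : Set ℝ) ∧ 0 ≤ β * y - c ∧ β * y - c ≤ m / (β - 1) := by
    intro y
    have h1 : 1 ≤ m / (β - 1) := by rw [le_div_iff₀ hβ1]; linarith
    by_cases hy1 : β * y < 1
    · exact ⟨0, fun hy => ⟨by simp, by nlinarith, by linarith⟩⟩
    by_cases hy2 : β * y < m
    · exact ⟨1, fun hy => ⟨by simp, by linarith, by linarith⟩⟩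
    · refine ⟨m, fun hy => ⟨by simp, by linarith, ?_⟩⟩
      have h2 : β * (m / (β - 1)) - m = m / (β - 1) := by field_simp; ring
      have := mul_le_mul_of_nonneg_left hy.2 h0.le
      linarith
  choose c hc using hstep
  set T : ℕ → ℝ := fun n => (fun y => β * y - c y)^[n] x with hT
  have hTs : ∀ n, T (n + 1) = β * T n - c (T n) := fun n => by
    simp only [hT, Function.iterate_succ_apply']
  have hmem : ∀ n, 0 ≤ T n ∧ T n ≤ m / (β - 1) := by
    intro n
    induction n with
    | zero => exact ⟨hx0, hx1⟩
    | succ n ih => rw [hTs]; exact (hc _ ih).2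
  have hsum : ∀ n, ∑ i ∈ Finset.range n, c (T i) / β ^ (i + 1) = x - T n / β ^ n := by
    intro n
    induction n with
    | zero => simp [hT]
    | succ n ih =>
      rw [Finset.sum_range_succ, ih, hTs, pow_succ]
      field_simp
      ring
  refine ⟨fun n => c (T n), fun n => (hc _ (hmem n)).1, ?_⟩
  have hnn : ∀ n, 0 ≤ c (T n) / β ^ (n + 1) := fun n => by
    have : 0 ≤ c (T n) := by
      rcases (hc _ (hmem n)).1 with h | h | h <;> rw [h] <;> linarith
    positivity
  refine ((hasSum_iff_tendsto_nat_of_nonneg hnn x).2 ?_).tsum_eq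
  simp only [hsum]
  have hlim : Filter.Tendsto (fun n => T n / β ^ n) Filter.atTop (nhds 0) := by
    have h := (tendsto_inv_atTop_zero.comp (tendsto_pow_atTop_atTop_of_one_lt hβ)).const_mul
      (m / (β - 1))
    rw [mul_zero] at h
    refine squeeze_zero (fun n => div_nonneg (hmem n).1 (by positivity)) (fun n => ?_) h
    simp only [Function.comp, ← div_eq_mul_inv]
    gcongr
    exact (hmem n).2
  simpa using hlim.const_sub x

lemma digit_abs_le {m x : ℝ} (hm : 1 < m) (hx : x ∈ ({0, 1, m} : Set ℝ)) : |x| ≤ m := by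
  rcases hx with h | h | h <;> rw [h, abs_of_nonneg] <;> linarith

lemma bR_mem_digits (m : ℝ) (u : ℕ → Bool) (k : ℕ) : bR u k ∈ ({0, 1, m} : Set ℝ) := by
  simp only [bR]; split_ifs <;> simp

/-- In a unique expansion no digit can be exchanged. -/
lemma Uset_digit_exchange {β m : ℝ} (hβ : 1 < β) (hm : 1 < m) (hm2 : m ≤ 2) (hβm : β ≤ 1 + m)
    {u : ℕ → Bool} (hu : bR u ∈ Uset β {0, 1, m}) (k : ℕ) {c : ℝ}
    (hc : c ∈ ({0, 1, m} : Set ℝ)) (hck : c ≠ bR u k)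
    (hlow : 0 ≤ bR u k + piB β (shiftW (k + 1) u) - c) :
    m / (β - 1) < bR u k + piB β (shiftW (k + 1) u) - c := by
  by_contra hupp
  obtain ⟨d, hd, hdx⟩ := exists_expansion hβ hm hm2 hβm hlow (not_lt.1 hupp)
  set v : ℕ → ℝ := fun i => if i < k then bR u i else if i = k then c else d (i - (k + 1)) with hv
  have hvk : v k = c := by simp [hv]
  have hvmem : ∀ i, v i ∈ ({0, 1, m} : Set ℝ) := by
    intro i
    simp only [hv]
    split_ifs
    exacts [bR_mem_digits m u i, hc, hd _]
  refine hu.2 v hvmem (fun h => hck (by rw [← hvk, h])) ?_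
  have hb := fun i => digit_abs_le hm (hvmem i)
  rw [piR_split hβ hb k, piR_split hβ (abs_bR_le u) k, piR_head hβ (fun i => hb (i + k)),
    piR_head hβ (fun i => abs_bR_le u (i + k))]
  have h1 : (fun i => v (i + 1 + k)) = d := by
    funext i
    have h2 : ¬ i + 1 + k < k := by omega
    have h3 : i + 1 + k ≠ k := by omega
    simp only [hv, h2, h3, if_false]
    congr 1
    omega
  have h2 : (fun i => bR u (i + 1 + k)) = bR (shiftW (k + 1) u) := by
    funext i
    show bR u (i + 1 + k) = bR u (i + (k + 1))
    congr 1
    omega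
  rw [h1, h2, piR_bR, hdx, zero_add, hvk]
  congr 1
  · refine Finset.sum_congr rfl fun i hi => ?_
    simp [hv, Finset.mem_range.1 hi]
  · ring

section Uset

variable {β m : ℝ} {v : ℕ → Bool}

lemma Uset_tail_lt_one (hβ : 1 < β) (hm : 1 < m) (hm2 : m ≤ 2) (hβm : β ≤ 1 + m)
    (hv : bR v ∈ Uset β {0, 1, m}) {k : ℕ} (hk : v k = false) :
    piB β (shiftW (k + 1) v) < 1 := by
  have h := Uset_digit_exchange hβ hm hm2 hβm hv k (c := 1) (by simp) (by simp [bR, hk])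
  simp only [bR, hk, Bool.false_eq_true, if_false] at h
  by_contra h1
  have h2 := h (by linarith)
  have h3 := piB_le hβ (shiftW (k + 1) v)
  have h4 : 1 / (β - 1) ≤ m / (β - 1) := by gcongr
  linarith

lemma Uset_tail_lt (hβ : 1 < β) (hm : 1 < m) (hm2 : m ≤ 2) (hβm : β ≤ 1 + m)
    (hv : bR v ∈ Uset β {0, 1, m}) {k : ℕ} (hk : v k = true) :
    piB β (shiftW (k + 1) v) < m - 1 := by
  have h := Uset_digit_exchange hβ hm hm2 hβm hv k (c := m) (by simp)
    (by simp [bR, hk]; linarith)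
  simp only [bR, hk, if_true] at h
  by_contra h1
  have h2 := h (by linarith)
  have h3 := piB_le hβ (shiftW (k + 1) v)
  have h4 : 1 / (β - 1) ≤ m / (β - 1) := by gcongr
  linarith

lemma Uset_lt_tail (hβ : 1 < β) (hm : 1 < m) (hm2 : m ≤ 2) (hβm : β ≤ 1 + m)
    (hv : bR v ∈ Uset β {0, 1, m}) {k : ℕ} (hk : v k = true) :
    m / (β - 1) < 1 + piB β (shiftW (k + 1) v) := by
  have h := Uset_digit_exchange hβ hm hm2 hβm hv k (c := 0) (by simp) (by simp [bR, hk])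
  simp only [bR, hk, if_true, sub_zero] at h
  have := piB_nonneg (by linarith : 0 ≤ β) (shiftW (k + 1) v)
  exact h (by linarith)

end Uset

/-- If the bound `m` exceeds `(β-1)(1+π_β(w))`, the suffixes following a `1` in a unique expansion
exceed `w`, uniformly. -/
lemma exists_prefixLt_lower {β m : ℝ} (hβ : 1 < β) (hm : 1 < m) (hm2 : m ≤ 2) {w : ℕ → Bool}
    (hw : (β - 1) * (1 + piB β w) < m) :
    ∃ N, ∀ v, bR v ∈ Uset β {0, 1, m} → ∀ k, v k = true → PrefixLt N w (shiftW (k + 1) v) := by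
  have h0 : (0 : ℝ) < β := by linarith
  have hβ1 : 0 < β - 1 := by linarith
  have hβm : β ≤ 1 + m := by nlinarith [piB_nonneg h0.le w]
  have hw' : 1 + piB β w < m / (β - 1) := by rw [lt_div_iff₀ hβ1]; linarith
  obtain ⟨N, hN⟩ := exists_tail_bound_lt hβ (sub_pos.2 hw')
  refine ⟨N, fun v hv k hk => ?_⟩
  have ht := Uset_lt_tail hβ hm hm2 hβm hv hk
  by_contra hn
  rcases not_prefixLt hn with h1 | ⟨n, -, h1, h2, h3⟩
  · have := piB_sub_le_of_agree hβ (u := shiftW (k + 1) v) (v := w) fun i hi => (h1 i hi).symm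
    linarith
  · have h4 := Uset_tail_lt_one hβ hm hm2 hβm hv (k := n + (k + 1)) h2
    have := piB_lt_of_agree_of_lt hβ h1 h2 h3 (by
      rw [shiftW_shiftW, Nat.add_right_comm]
      have := piB_nonneg h0.le (shiftW (n + 1) w)
      linarith)
    linarith

/-- If `β π_β(s)` exceeds the bound `m`, the suffixes starting with `1` in a unique expansion
are smaller than `s`, uniformly. -/
lemma exists_prefixLt_upper {β m : ℝ} (hβ : 1 < β) (hm : 1 < m) (hm2 : m ≤ 2) (hβm : β ≤ 1 + m)
    {s : ℕ → Bool} (hs : m < β * piB β s) :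
    ∃ N, ∀ v, bR v ∈ Uset β {0, 1, m} → ∀ k, v k = true → PrefixLt N (shiftW k v) s := by
  have h0 : (0 : ℝ) < β := by linarith
  have hβ1 : 0 < β - 1 := by linarith
  have hs' : m / β < piB β s := by rw [div_lt_iff₀ h0]; linarith
  obtain ⟨N, hN⟩ := exists_tail_bound_lt hβ (sub_pos.2 hs')
  refine ⟨N, fun v hv k hk => ?_⟩
  have ht : piB β (shiftW k v) < m / β := by
    rw [piB_head hβ]
    have := Uset_tail_lt hβ hm hm2 hβm hv hk
    simp only [shiftW_apply_zero, hk, if_true, shiftW_shiftW, Nat.add_comm 1 k]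
    gcongr
    linarith
  by_contra hn
  rcases not_prefixLt hn with h1 | ⟨n, -, h1, h2, h3⟩
  · have := piB_sub_le_of_agree hβ (u := s) (v := shiftW k v) fun i hi => (h1 i hi).symm
    linarith
  · have h4 := Uset_lt_tail hβ hm hm2 hβm hv (k := n + k) h3
    have := piB_lt_of_agree_of_lt hβ h1 h2 h3 (by
      rw [shiftW_shiftW, Nat.add_right_comm]
      have h5 := piB_le hβ (shiftW (n + 1) s)
      have h6 : 1 / (β - 1) ≤ m / (β - 1) := by gcongr
      linarith)
    linarith

lemma countable_Uset_inter {β : ℝ} {A : Set ℝ} {C : Set (ℕ → Bool)} (hC : C.Countable)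
    (h : ∀ v, bR v ∈ Uset β A → ∀ k, v k = true → ∃ j, shiftW j v ∈ C) :
    (Uset β A ∩ {v | ∃ u : ℕ → Bool, v = bR u}).Countable := by
  refine (((countable_shiftW_mem hC).union (Set.countable_singleton w0bar)).image bR).mono ?_
  rintro _ ⟨hv, v, rfl⟩
  refine ⟨v, ?_, rfl⟩
  by_cases hk : ∃ k, v k = true
  · obtain ⟨k, hk⟩ := hk
    exact Or.inl (h v hv k hk)
  · push Not at hk
    exact Or.inr (funext fun i => by simpa [w0bar] using hk i)

/-- Countably many unique expansions exist when `m` is beyond the critical values of `w` and `s`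
and these are, up to finite prefixes, beyond bounds `a`, `b` with `betweenSet a b` countable. -/
lemma countable_Uset_of_betweenSet {β m : ℝ} (hβ : 1 < β) (hm : 1 < m) (hm2 : m ≤ 2)
    {w s : ℕ → Bool} (hw : (β - 1) * (1 + piB β w) < m) (hs : m < β * piB β s)
    (hab : ∀ N, ∃ a b, b 0 = true ∧ (betweenSet a b).Countable ∧
      (∀ t, PrefixLt N w t → lexLt a t) ∧ ∀ t, PrefixLt N t s → lexLt t b) :
    (Uset β {0, 1, m} ∩ {v | ∃ u : ℕ → Bool, v = bR u}).Countable := by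
  have hβm : β ≤ 1 + m := by nlinarith [piB_nonneg (by linarith : 0 ≤ β) w]
  obtain ⟨N₁, h1⟩ := exists_prefixLt_lower hβ hm hm2 hw
  obtain ⟨N₂, h2⟩ := exists_prefixLt_upper hβ hm hm2 hβm hs
  obtain ⟨a, b, hb, hc, ha', hb'⟩ := hab (max N₁ N₂)
  have hmono : ∀ {N u v}, N ≤ max N₁ N₂ → PrefixLt N u v → PrefixLt (max N₁ N₂) u v :=
    fun hN ⟨n, hn, h⟩ => ⟨n, hn.trans_le hN, h⟩
  refine countable_Uset_inter hc fun v hv k hk => ⟨k + 1, fun j => ⟨?_, ?_⟩⟩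
  · have hlow := fun i hi => ha' _ (hmono (le_max_left _ _) (h1 v hv i hi))
    refine suffix_gt_of_true (hlow k hk) (fun i hi => ?_) j
    rw [shiftW_shiftW, Nat.add_right_comm]
    exact hlow _ hi
  · rw [shiftW_shiftW]
    cases hj : v (j + (k + 1))
    · exact lexLt_of_head (by simpa using hj) hb
    · exact hb' _ (hmono (le_max_right _ _) (h2 v hv _ hj))

/-! ### The curves `f_u` and `g_u` -/

lemma continuousOn_piB {c : ℝ} (hc : 1 < c) (u : ℕ → Bool) :
    ContinuousOn (fun β => piB β u) (Set.Ici c) := by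
  have h0 : 0 < c := by linarith
  refine continuousOn_tsum (u := fun k : ℕ => 1 / c ^ (k + 1)) (fun k => ?_)
    (hasSum_one_div_pow hc).summable fun k β hβ => ?_
  · refine continuousOn_const.div (by fun_prop) fun β hβ => ?_
    have : 0 < β := h0.trans_le hβ
    positivity
  · have hβ' : c ≤ β := hβ
    have : 0 < β := h0.trans_le hβ'
    rw [Real.norm_eq_abs, abs_of_nonneg (div_nonneg (by split_ifs <;> simp) (by positivity))]
    gcongr
    split_ifs <;> simp

lemma continuousOn_gCurve {c : ℝ} (hc : 1 < c) (u : ℕ → Bool) :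
    ContinuousOn (fun β => (β - 1) * (1 + piB β u)) (Set.Ici c) :=
  ContinuousOn.mul (by fun_prop) (continuousOn_const.add (continuousOn_piB hc u))

lemma piR_const_sub {β : ℝ} (hβ : 1 < β) (m : ℝ) (w : ℕ → Bool) :
    piR β (fun k => m - bR w k) = m / (β - 1) - piB β w := by
  have h := ((hasSum_one_div_pow hβ).mul_left m).sub (summable_piB hβ w).hasSum
  rw [mul_one_div] at h
  rw [piB, ← h.tsum_eq, piR]
  refine tsum_congr fun k => ?_
  rw [bR, sub_div, mul_one_div]

lemma bR_lt {m : ℝ} (hm : 1 < m) (w : ℕ → Bool) (k : ℕ) : 0 < m - bR w k := by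
  have := (abs_le.1 (abs_bR_le w k)).2
  linarith

lemma lt_gCurve_of_le {b c m : ℝ} (hb : 1 < b) (hbc : b < c) (hm : 1 < m) {w : ℕ → Bool}
    (h : m ≤ (b - 1) * (1 + piB b w)) : m < (c - 1) * (1 + piB c w) := by
  have hc := hb.trans hbc
  have hs : ∀ {β : ℝ}, 1 < β → Summable fun k => (m - bR w k) / β ^ (k + 1) := fun hβ =>
    summable_piR (C := m + 1) hβ fun k => (abs_sub _ _).trans (by
      rw [abs_of_pos (by linarith : 0 < m)]
      linarith [abs_bR_le w k])
  have hlt : piR c (fun k => m - bR w k) < piR b (fun k => m - bR w k) := by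
    refine Summable.tsum_lt_tsum (i := 0) (fun k => ?_) ?_ (hs hc) (hs hb)
    · have := bR_lt hm w k
      gcongr
    · have := bR_lt hm w 0
      gcongr
  rw [piR_const_sub hc, piR_const_sub hb] at hlt
  have h1 : m / (b - 1) ≤ 1 + piB b w := by
    rw [div_le_iff₀ (by linarith)]; linarith
  have h2 : m / (c - 1) < 1 + piB c w := by linarith
  rw [div_lt_iff₀ (by linarith)] at h2
  linarith

lemma gVal_eq {m β : ℝ} (hm : 1 < m) (hβ : 1 < β) {u : ℕ → Bool}
    (h : (β - 1) * (1 + piB β (infO u)) = m) : gVal u m = β := by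
  have : {β : ℝ | 1 < β ∧ (β - 1) * (1 + piB β (infO u)) = m} = {β} := by
    refine Set.eq_singleton_iff_unique_mem.2 ⟨⟨hβ, h⟩, fun c ⟨hc, hc'⟩ => ?_⟩
    rcases lt_trichotomy c β with h1 | h1 | h1
    · exact absurd h (lt_gCurve_of_le hc h1 hm hc'.ge).ne'
    · exact h1
    · exact absurd hc' (lt_gCurve_of_le hβ h1 hm h.ge).ne'
  rw [gVal, this, csInf_singleton]

lemma gVal_spec {m : ℝ} (hm : 1 < m) (u : ℕ → Bool) :
    1 < gVal u m ∧ gVal u m ≤ 1 + m ∧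
      (gVal u m - 1) * (1 + piB (gVal u m) (infO u)) = m := by
  have h1 : (m - 1) * (1 + piB m (infO u)) ≤ m := by
    have h2 := piB_le hm (infO u)
    rw [le_div_iff₀ (by linarith)] at h2
    linarith
  have h2 : m ≤ (1 + m - 1) * (1 + piB (1 + m) (infO u)) := by
    have := piB_nonneg (by linarith : 0 ≤ 1 + m) (infO u)
    nlinarith
  obtain ⟨β, hβ, h3⟩ := intermediate_value_Icc (by linarith : m ≤ 1 + m)
    ((continuousOn_gCurve hm (infO u)).mono Set.Icc_subset_Ici_self) ⟨h1, h2⟩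
  have hβ1 : 1 < β := hm.trans_le hβ.1
  rw [gVal_eq hm hβ1 h3]
  exact ⟨hβ1, hβ.2, h3⟩

lemma gCurve_lt {m β : ℝ} (hm : 1 < m) (hβ : 1 < β) {u : ℕ → Bool} (h : β < gVal u m) :
    (β - 1) * (1 + piB β (infO u)) < m := by
  by_contra h1
  exact (lt_gCurve_of_le hβ h hm (not_lt.1 h1)).ne' (gVal_spec hm u).2.2

lemma gVal_lt_gVal {m m' : ℝ} (hm : 1 < m) (h : m < m') (u : ℕ → Bool) :
    gVal u m < gVal u m' := by
  obtain ⟨h1, -, h2⟩ := gVal_spec hm u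
  obtain ⟨h3, -, h4⟩ := gVal_spec (hm.trans h) u
  by_contra h5
  rcases (not_lt.1 h5).lt_or_eq with h6 | h6
  · linarith [lt_gCurve_of_le h3 h6 (hm.trans h) h4.ge]
  · rw [h6] at h4
    linarith

lemma fCurve_lt {b c : ℝ} (hb : 1 ≤ b) (hbc : b < c) {s : ℕ → Bool}
    (hs : Summable fun k => (if s k then (1 : ℝ) else 0) / b ^ (k + 1))
    (h : 1 < c * piB c s) : c * piB c s < b * piB b s := by
  have hc : 1 < c := hb.trans_lt hbc
  have h0 : 0 < c := by linarith
  have h0' : 0 < b := by linarith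
  have hk : ∃ k, s (k + 1) = true := by
    by_contra! hk
    have : piB c s = (if s 0 then (1 : ℝ) else 0) / c ^ (0 + 1) := tsum_eq_single 0 fun k hk0 => by
      obtain ⟨k, rfl⟩ := Nat.exists_eq_succ_of_ne_zero hk0
      simp [hk k]
    rw [this, zero_add, pow_one, mul_div_cancel₀ _ h0.ne'] at h
    split_ifs at h <;> linarith
  obtain ⟨k, hk⟩ := hk
  have hterm : ∀ (β : ℝ) (d : ℝ) (k : ℕ), 0 < β → β * (d / β ^ (k + 1)) = d / β ^ k := by
    intro β d k hβ
    rw [pow_succ]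
    field_simp
  rw [piB, piB, ← tsum_mul_left, ← tsum_mul_left]
  refine Summable.tsum_lt_tsum (i := k + 1) (fun j => ?_) ?_ ((summable_piB hc s).mul_left c)
    (hs.mul_left b)
  · simp only [hterm _ _ _ h0, hterm _ _ _ h0']
    gcongr
  · simp only [hterm _ _ _ h0, hterm _ _ _ h0', hk, if_true]
    gcongr

lemma fCurve_root_unique {b c m : ℝ} (hm : 1 < m) (hb : 1 ≤ b) (hc : 1 ≤ c) {s : ℕ → Bool}
    (hb' : b * piB b s = m) (hc' : c * piB c s = m) : b = c := by
  have key : ∀ {b c : ℝ}, 1 ≤ b → b * piB b s = m → c * piB c s = m → ¬ b < c := by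
    intro b c hb hb' hc' h
    refine (fCurve_lt hb h ?_ (by linarith)).ne (hc'.trans hb'.symm)
    by_contra hs
    rw [piB, tsum_eq_zero_of_not_summable hs] at hb'
    linarith
  exact le_antisymm (not_lt.1 (key hc hc' hb')) (not_lt.1 (key hb hb' hc'))

lemma fVal_eq {m β : ℝ} (hm : 1 < m) (hβ : 1 ≤ β) {u : ℕ → Bool}
    (h : β * piB β (supO u) = m) : fVal u m = β := by
  have : {β : ℝ | 1 ≤ β ∧ β * piB β (supO u) = m} = {β} :=
    Set.eq_singleton_iff_unique_mem.2
      ⟨⟨hβ, h⟩, fun c ⟨hc, hc'⟩ => fCurve_root_unique hm hc hβ hc' h⟩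
  rw [fVal, this, csInf_singleton]

lemma fVal_spec {m : ℝ} (hm : 1 < m) {u : ℕ → Bool} (h : 0 < fVal u m) :
    fVal u m * piB (fVal u m) (supO u) = m := by
  have hne : {β : ℝ | 1 ≤ β ∧ β * piB β (supO u) = m}.Nonempty := by
    by_contra hne
    rw [fVal, Set.not_nonempty_iff_eq_empty.1 hne, Real.sInf_empty] at h
    exact lt_irrefl _ h
  obtain ⟨β, hβ, h1⟩ := hne
  rwa [fVal_eq hm hβ h1]

lemma lt_fCurve {m β : ℝ} (hm : 1 < m) (hβ : 1 < β) {u : ℕ → Bool} (h : β < fVal u m) :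
    m < β * piB β (supO u) := by
  have h1 := fVal_spec hm (by linarith : 0 < fVal u m)
  have := fCurve_lt hβ.le h (summable_piB hβ (supO u)) (by linarith)
  linarith

lemma crossing_unique {m m' : ℝ} (hm : 1 < m) (hm' : 1 < m') {u : ℕ → Bool}
    (h : fVal u m = gVal u m) (h' : fVal u m' = gVal u m') : m = m' := by
  have key : ∀ {m m' : ℝ}, 1 < m → 1 < m' → fVal u m = gVal u m → fVal u m' = gVal u m' →
      ¬ m < m' := by
    intro m m' hm hm' h h' hlt
    have h1 := (gVal_spec hm u).1
    have h2 := gVal_lt_gVal hm hlt u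
    have h3 := fVal_spec hm (u := u) (by linarith)
    have h4 := lt_fCurve hm' h1 (u := u) (by linarith)
    rw [h] at h3
    linarith
  exact le_antisymm (not_lt.1 (key hm' hm h' h)) (not_lt.1 (key hm hm' h h'))

lemma muVal_eq {m : ℝ} (hm : 1 < m) (hm2 : m ≤ 2) {u : ℕ → Bool} (h : fVal u m = gVal u m) :
    muVal u = m := by
  have : {m : ℝ | 1 < m ∧ m ≤ 2 ∧ fVal u m = gVal u m} = {m} :=
    Set.eq_singleton_iff_unique_mem.2
      ⟨⟨hm, hm2, h⟩, fun c ⟨hc, _, hc'⟩ => crossing_unique hc hm hc' h⟩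
  rw [muVal, this, csInf_singleton]

/-- Below `μ_u`, the region `β < g_u(m)` lies below both curves. -/
lemma below_curves_of_le_muVal {m β : ℝ} (hm : 1 < m) (hβ : 1 < β) {u : ℕ → Bool}
    (hmu : m ≤ muVal u) (h : β < gVal u m) :
    (β - 1) * (1 + piB β (infO u)) < m ∧ m < β * piB β (supO u) := by
  refine ⟨gCurve_lt hm hβ h, ?_⟩
  have hne : {m : ℝ | 1 < m ∧ m ≤ 2 ∧ fVal u m = gVal u m}.Nonempty := by
    by_contra hne
    rw [muVal, Set.not_nonempty_iff_eq_empty.1 hne, Real.sInf_empty] at hmu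
    linarith
  obtain ⟨m', h1, h2, h3⟩ := hne
  rw [muVal_eq h1 h2 h3] at hmu
  have h4 : gVal u m ≤ gVal u m' := by
    rcases hmu.lt_or_eq with h4 | rfl
    · exact (gVal_lt_gVal hm h4 u).le
    · rfl
  exact hmu.trans_lt (lt_fCurve h1 hβ (by linarith))

/-- Above `μ_u`, the region `β < f_u(m)` lies below both curves. -/
lemma below_curves_of_muVal_le {m β : ℝ} (hm : 1 < m) (hm2 : m ≤ 2) (hβ : 1 < β)
    {u : ℕ → Bool} (hmu : muVal u ≤ m) (h : β < fVal u m) :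
    (β - 1) * (1 + piB β (infO u)) < m ∧ m < β * piB β (supO u) := by
  have hF := lt_fCurve hm hβ h
  refine ⟨?_, hF⟩
  by_contra hG
  obtain ⟨hg1, hg2, hg3⟩ := gVal_spec hm u
  have hgβ : gVal u m ≤ β := by
    by_contra h1
    exact hG (gCurve_lt hm hβ (not_le.1 h1))
  have hgF : m < gVal u m * piB (gVal u m) (supO u) := lt_fCurve hm hg1 (by linarith)
  have h3F : 3 * piB 3 (supO u) ≤ (3 - 1) * (1 + piB 3 (infO u)) := by
    have := piB_le (by norm_num : (1 : ℝ) < 3) (supO u)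
    have := piB_nonneg (by norm_num : (0 : ℝ) ≤ 3) (infO u)
    norm_num at *
    linarith
  have hcont : ContinuousOn
      (fun β => (β - 1) * (1 + piB β (infO u)) - β * piB β (supO u)) (Set.Icc (gVal u m) 3) :=
    ((continuousOn_gCurve hg1 (infO u)).sub
      (continuousOn_id.mul (continuousOn_piB hg1 (supO u)))).mono Set.Icc_subset_Ici_self
  obtain ⟨c, ⟨hc1, hc2⟩, hc⟩ := intermediate_value_Icc (by linarith : gVal u m ≤ 3) hcont
    (show (0 : ℝ) ∈ Set.Icc _ _ from ⟨by linarith, by linarith⟩)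
  have hc' : 1 < c := by linarith
  set m' := c * piB c (supO u) with hm'
  have hGc : (c - 1) * (1 + piB c (infO u)) = m' := by
    simp only at hc
    linarith
  have hmm' : m ≤ m' := by
    rcases hc1.lt_or_eq with h1 | h1
    · exact hGc ▸ (lt_gCurve_of_le hg1 h1 hm hg3.ge).le
    · rw [hm', ← h1]; exact hgF.le
  have hm'2 : m' ≤ 2 := by
    have hi := piB_le hc' (infO u)
    have hs := piB_le hc' (supO u)
    rw [le_div_iff₀ (by linarith)] at hi hs
    by_cases h2 : c ≤ 2
    · rw [← hGc]; linarith
    · have := piB_nonneg (by linarith : 0 ≤ c) (supO u)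
      nlinarith
  have hm'1 : 1 < m' := by linarith
  have hf := fVal_eq hm'1 hc'.le hm'.symm
  have hg := gVal_eq hm'1 hc' hGc
  rw [muVal_eq hm'1 hm'2 (hf.trans hg.symm)] at hmu
  have hmm := le_antisymm hmm' hmu
  rw [← hmm] at hf hg
  linarith

/-! ### The set defining `𝓛(m)` is nonempty -/

lemma abs_piR_le {β C : ℝ} (hβ : 1 < β) {d : ℕ → ℝ} (hd : ∀ k, |d k| ≤ C) :
    |piR β d| ≤ C / (β - 1) := by
  have h := (hasSum_one_div_pow hβ).mul_left C
  rw [mul_one_div] at h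
  rw [← Real.norm_eq_abs]
  refine tsum_of_norm_bounded h fun k => ?_
  have h0 : 0 < β := by linarith
  rw [Real.norm_eq_abs, abs_div, abs_of_pos (pow_pos h0 _), mul_one_div]
  gcongr
  exact hd k

lemma Uset_of_large {β m : ℝ} (hm : 1 < m) (hm2 : m ≤ 2) (hβ : 1 < β)
    (h : 2 * m / (β - 1) < m - 1) {u : ℕ → ℝ} (hu : ∀ k, u k ∈ ({0, 1, m} : Set ℝ)) :
    u ∈ Uset β {0, 1, m} := by
  classical
  refine ⟨hu, fun v hv hne heq => ?_⟩
  have h0 : 0 < β := by linarith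
  have hex : ∃ k, v k ≠ u k := Function.ne_iff.1 hne
  set k := Nat.find hex
  have hk : v k ≠ u k := Nat.find_spec hex
  have hlt : ∀ i < k, v i = u i := fun i hi => not_not.1 (Nat.find_min hex hi)
  have hd : ∀ i, |v i - u i| ≤ 2 * m := fun i => (abs_sub _ _).trans (by
    linarith [digit_abs_le hm (hv i), digit_abs_le hm (hu i)])
  have hzero : piR β (fun i => v i - u i) = 0 := by
    have h1 := (summable_piR hβ fun i => digit_abs_le hm (hv i)).tsum_sub
      (summable_piR hβ fun i => digit_abs_le hm (hu i))
    simp only [← sub_div] at h1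
    exact h1.trans (sub_eq_zero.2 heq)
  rw [piR_split hβ hd k, piR_head hβ fun i => hd (i + k), Finset.sum_eq_zero fun i hi => by
    rw [hlt i (Finset.mem_range.1 hi), sub_self, zero_div], zero_add, zero_add, div_div] at hzero
  have h1 : v k - u k + piR β (fun i => v (i + 1 + k) - u (i + 1 + k)) = 0 := by
    rcases div_eq_zero_iff.1 hzero with h1 | h1
    · exact h1
    · exact absurd h1 (by positivity)
  have h2 := (abs_piR_le hβ fun i => hd (i + 1 + k)).trans_lt h
  have h3 : m - 1 ≤ |v k - u k| := by
    rcases hv k with h4 | h4 | h4 <;> rcases hu k with h5 | h5 | h5 <;>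
      rw [h4, h5] at hk ⊢ <;> first
      | exact absurd rfl hk
      | (rw [le_abs]; left; linarith)
      | (rw [le_abs]; right; linarith)
  rw [eq_neg_of_add_eq_zero_left h1, abs_neg] at h3
  linarith

lemma bR_injective : Function.Injective bR := by
  intro u v h
  funext k
  have := congrFun h k
  simp only [bR] at this
  cases hu : u k <;> cases hv : v k <;> simp_all

lemma exists_uncountable_Uset {m : ℝ} (hm : 1 < m) (hm2 : m ≤ 2) :
    ∃ β : ℝ, 1 < β ∧ ¬ (Uset β {0, 1, m} ∩ {v | ∃ u : ℕ → Bool, v = bR u}).Countable := by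
  have hm1 : 0 < m - 1 := by linarith
  have hpos : 0 < 4 * m / (m - 1) := by positivity
  have hlt : 2 * m / (1 + 4 * m / (m - 1) - 1) < m - 1 := by
    have : 2 * m / (1 + 4 * m / (m - 1) - 1) = (m - 1) / 2 := by
      rw [add_sub_cancel_left]
      field_simp
      norm_num
    linarith
  refine ⟨1 + 4 * m / (m - 1), by linarith, fun hc => ?_⟩
  have h1 : (Set.range bR).Countable := hc.mono (by
    rintro _ ⟨u, rfl⟩
    exact ⟨Uset_of_large hm hm2 (by linarith) hlt (bR_mem_digits m u), u, rfl⟩)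
  have h2 : Countable (ℕ → Bool) :=
    Set.countable_univ_iff.1 ((Set.countable_univ_iff.2 h1.to_subtype).preimage_of_injOn
      (f := fun u => (⟨bR u, u, rfl⟩ : Set.range bR))
      fun u _ v _ h => bR_injective (congrArg Subtype.val h))
  have h3 := Cardinal.mk_le_aleph0_iff.2 h2
  simp only [Cardinal.mk_pi, Cardinal.mk_bool, Cardinal.prod_const, Cardinal.mk_nat,
    Cardinal.lift_id] at h3
  exact (Cardinal.cantor _).not_ge h3

lemma le_Lval {m c : ℝ} (hm : 1 < m) (hm2 : m ≤ 2)
    (h : ∀ β, 1 < β → β < c →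
      (Uset β {0, 1, m} ∩ {v | ∃ u : ℕ → Bool, v = bR u}).Countable) : c ≤ Lval m :=
  le_csInf (exists_uncountable_Uset hm hm2) fun β ⟨hβ, hβ'⟩ =>
    not_lt.1 fun hlt => hβ' (h β hβ hlt)

/-! ### Lower bounds -/

lemma gVal_le_Lval {m : ℝ} (hm : 1 < m) (hm2 : m ≤ 2) {u : ℕ → Bool} (hmu : m ≤ muVal u)
    (hab : ∀ N, ∃ a b, b 0 = true ∧ (betweenSet a b).Countable ∧
      (∀ t, PrefixLt N (infO u) t → lexLt a t) ∧ ∀ t, PrefixLt N t (supO u) → lexLt t b) :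
    gVal u m ≤ Lval m :=
  le_Lval hm hm2 fun _ hβ hlt =>
    have h := below_curves_of_le_muVal hm hβ hmu hlt
    countable_Uset_of_betweenSet hβ hm hm2 h.1 h.2 hab

lemma fVal_le_Lval {m : ℝ} (hm : 1 < m) (hm2 : m ≤ 2) {u : ℕ → Bool} (hmu : muVal u ≤ m)
    (hab : ∀ N, ∃ a b, b 0 = true ∧ (betweenSet a b).Countable ∧
      (∀ t, PrefixLt N (infO u) t → lexLt a t) ∧ ∀ t, PrefixLt N t (supO u) → lexLt t b) :
    fVal u m ≤ Lval m :=
  le_Lval hm hm2 fun _ hβ hlt =>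
    have h := below_curves_of_muVal_le hm hm2 hβ hmu hlt
    countable_Uset_of_betweenSet hβ hm hm2 h.1 h.2 hab

lemma exists_bounds_of_suffixBounds {u a b : ℕ → Bool} (h : SuffixBounds a b u)
    (hb : b 0 = true) (hc : (betweenSet a b).Countable) (N : ℕ) :
    ∃ a b, b 0 = true ∧ (betweenSet a b).Countable ∧
      (∀ t, PrefixLt N (infO u) t → lexLt a t) ∧ ∀ t, PrefixLt N t (supO u) → lexLt t b :=
  ⟨a, b, hb, hc, fun _ ht => (ht.lexLe_trans h.lexLe_infO).lexLt,
    fun _ ht => (ht.trans_lexLe h.supO_lexLe).lexLt⟩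

lemma gVal_w01bar_le_Lval {m : ℝ} (hm : 1 < m) (hm2 : m ≤ 2) : gVal w01bar m ≤ Lval m := by
  refine le_Lval hm hm2 fun β hβ hlt => ?_
  have hw := gCurve_lt hm hβ hlt
  rw [suffixBounds_w01bar.infO_eq (shiftW_mem_orbit 0 _)] at hw
  obtain ⟨N, hN⟩ := exists_prefixLt_lower hβ hm hm2 hw
  refine countable_Uset_inter (Set.countable_singleton w1bar) fun v hv k hk => ⟨k, ?_⟩
  have h1 : ∀ j, v (j + k) = true := by
    intro j
    induction j with
    | zero => simpa using hk
    | succ j ih =>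
      have h2 := (hN v hv _ ih).lexLt
      by_contra h3
      have h4 : shiftW (j + k + 1) v 0 = false := by
        rw [shiftW_apply_zero]
        simpa [Nat.add_right_comm] using h3
      rw [eq_consB_of_head h4, w01bar_eq, lexLt_consB_same] at h2
      exact not_lexLt.2 (lexLe_w1bar _) h2
  exact funext h1

lemma gVal_substApply_w10bar_le_Lval {m : ℝ} (hm : 1 < m) (hm2 : m ≤ 2)
    {σ : Bool → List Bool} (hσ : σ ∈ LMRstar) (hmu : m ≤ muVal (substApply σ w010bar)) :
    gVal (substApply σ w10bar) m ≤ Lval m := by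
  obtain ⟨α, β, N, h⟩ := exists_boundTransport_of_mem_LMRstar hσ
  have h1 := h.bounds _ _ _ rfl rfl suffixBounds_w10bar
  have h2 := h.bounds _ _ _ rfl rfl suffixBounds_w010bar
  have h3 := h1.infO_eq (mem_orbit_of_consB (h.lower_mem w0bar w10bar ⟨0, w10bar_eq.symm⟩))
  have h4 := h2.infO_eq (mem_orbit_of_consB (h.lower_mem w0bar w010bar
    ⟨1, by rw [w010bar_eq, ← w10bar_eq]; rfl⟩))
  have h5 : gVal (substApply σ w10bar) m = gVal (substApply σ w010bar) m := by
    rw [gVal, gVal, h3, h4]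
  rw [h5]
  exact gVal_le_Lval hm hm2 hmu (exists_bounds_of_suffixBounds h2 (h.upper_head _ rfl)
    (h.countable _ _ rfl rfl betweenSet_w0bar_w10bar_countable))

lemma fVal_substApply_w01bar_le_Lval {m : ℝ} (hm : 1 < m) (hm2 : m ≤ 2)
    {σ : Bool → List Bool} (hσ : σ ∈ LMRstar) (hmu : muVal (substApply σ w101bar) ≤ m) :
    fVal (substApply σ w01bar) m ≤ Lval m := by
  obtain ⟨α, β, N, h⟩ := exists_boundTransport_of_mem_LMRstar hσ
  have h1 := h.bounds _ _ _ rfl rfl suffixBounds_w01bar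
  have h2 := h.bounds _ _ _ rfl rfl suffixBounds_w101bar
  have h3 := h1.supO_eq (mem_orbit_of_consB (h.upper_mem w1bar w01bar rfl ⟨0, w01bar_eq.symm⟩))
  have h4 := h2.supO_eq (mem_orbit_of_consB (h.upper_mem w1bar w101bar rfl
    ⟨1, by rw [w101bar_eq, ← w01bar_eq]; rfl⟩))
  have h5 : fVal (substApply σ w01bar) m = fVal (substApply σ w101bar) m := by
    rw [fVal, fVal, h3, h4]
  rw [h5]
  exact fVal_le_Lval hm hm2 hmu (exists_bounds_of_suffixBounds h2 (h.upper_head _ rfl)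
    (h.countable _ _ rfl rfl betweenSet_w01bar_w1bar_countable))

lemma exists_bounds_of_mem_Sset {u : ℕ → Bool} (hu : u ∈ Sset) (N : ℕ) :
    ∃ a b, b 0 = true ∧ (betweenSet a b).Countable ∧
      (∀ t, PrefixLt N (infO u) t → lexLt a t) ∧ ∀ t, PrefixLt N t (supO u) → lexLt t b := by
  obtain ⟨σseq, hσ, -, hlim⟩ := hu
  obtain ⟨S, α, β, v, h, rfl⟩ := exists_boundTransport_of_limitWord hσ hlim N
  have h1 : SuffixBounds (α w0bar) (β w1bar) (S v) :=
    h.bounds _ _ _ rfl rfl fun k => ⟨w0bar_lexLe _, lexLe_w1bar _⟩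
  have h2 : Agree (0 + 1 + N) (α w01bar) (α w0bar) :=
    h.lower_agree _ _ _ rfl rfl fun i hi => by
      obtain rfl : i = 0 := by omega
      rfl
  exact ⟨α w01bar, β w1bar, h.upper_head _ rfl,
    h.countable _ _ rfl rfl betweenSet_w01bar_w1bar_countable,
    fun _ ht => ((ht.lexLe_trans h1.lexLe_infO).agree_left (h2.mono (by omega))).lexLt,
    fun _ ht => (ht.trans_lexLe h1.supO_lexLe).lexLt⟩

/-- Lower bounds for `𝓛(m)`. -/
theorem L_lower_bounds (m : ℝ) (hm : m ∈ Set.Ioc (1 : ℝ) 2) :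
    gVal w01bar m ≤ Lval m ∧
    (∀ σ ∈ LMRstar, m ≤ muVal (substApply σ w010bar) →
      gVal (substApply σ w10bar) m ≤ Lval m) ∧
    (∀ σ ∈ LMRstar, muVal (substApply σ w101bar) ≤ m →
      fVal (substApply σ w01bar) m ≤ Lval m) ∧
    (∀ u ∈ Sset,
      (m ≤ muVal u → gVal u m ≤ Lval m) ∧
      (muVal u ≤ m → fVal u m ≤ Lval m)) := by
  obtain ⟨hm1, hm2⟩ := hm
  exact ⟨gVal_w01bar_le_Lval hm1 hm2,
    fun _ hσ hmu => gVal_substApply_w10bar_le_Lval hm1 hm2 hσ hmu,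
    fun _ hσ hmu => fVal_substApply_w01bar_le_Lval hm1 hm2 hσ hmu,
    fun _ hu => ⟨fun hmu => gVal_le_Lval hm1 hm2 hmu (exists_bounds_of_mem_Sset hu),
      fun hmu => fVal_le_Lval hm1 hm2 hmu (exists_bounds_of_mem_Sset hu)⟩⟩
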